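/- arXiv:2110.06984 — 8 statements merged into one kernel-verified Lean document; each statement's English description precedes it below -/
import Mathlib

section
/- There exists a constant C > 0 such that for every n and all n × n real matrices A and B, ‖A ⊗ B‖_{B(ℓ∞,ℓ¹)} ≤ C·‖A‖_{B(ℓ∞,ℓ¹)}·‖B‖_{B(ℓ∞,ℓ¹)}, where A ⊗ B is the n² × n² Kronecker (tensor) product. (In the paper the constant is (π/2)·K_G², where K_G is the Grothendieck constant, 1.676 < K_G < 1.782.) -/
open MeasureTheory Filter

/-- The `(∞,1)`-norm of an `n × n` real matrix: `sup_{‖x‖∞ ≤ 1} ‖Ax‖₁`. -/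
noncomputable def normInfOne {n : ℕ} (A : Matrix (Fin n) (Fin n) ℝ) : ℝ :=
  sSup {r : ℝ | ∃ x : Fin n → ℝ, (∀ j, |x j| ≤ 1) ∧ r = ∑ i, |∑ j, A i j * x j|}
/-- Kronecker (tensor) product of two `n × n` matrices, as an `n² × n²` matrix with
lexicographic indexing: the entry at `(i*n + k, j*n + l)` is `A i j * B k l`
(`finProdFinEquiv (i,k) = i*n + k`). -/
noncomputable def kron {n : ℕ} (A B : Matrix (Fin n) (Fin n) ℝ) :
    Matrix (Fin (n * n)) (Fin (n * n)) ℝ :=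
  Matrix.reindex finProdFinEquiv finProdFinEquiv (Matrix.kroneckerMap (· * ·) A B)

section Grothendieck

open Matrix
open scoped MatrixOrder

/-- Orthonormal functions on a finite uniform probability space (Rademacher functions) whose linear
combinations satisfy the Khintchine inequality between the second and fourth moments. -/
theorem exists_orthonormal_fourth_moment_le {ι : Type*} [DecidableEq ι] (s : Finset ι) :
    ∃ (Ω : Type) (_ : Fintype Ω) (_ : Nonempty Ω) (e : ι → Ω → ℝ),
      (∀ a c : ι → ℝ, ∑ ω, (∑ i ∈ s, a i * e i ω) * (∑ i ∈ s, c i * e i ω)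
        = Fintype.card Ω * ∑ i ∈ s, a i * c i) ∧
      ∀ a : ι → ℝ, ∑ ω, (∑ i ∈ s, a i * e i ω) ^ 4
        ≤ 3 * Fintype.card Ω * (∑ i ∈ s, a i ^ 2) ^ 2 := by
  induction s using Finset.induction_on with
  | empty => exact ⟨Unit, inferInstance, inferInstance, fun _ _ => 0, by simp, by simp⟩
  | insert i s hi ih =>
    obtain ⟨Ω, _, _, e, h2, h4⟩ := ih
    let e' : ι → Ω × Bool → ℝ := fun j p =>
      if j = i then (if p.2 then 1 else -1) else e j p.1
    have hs : ∀ (a : ι → ℝ) (p : Ω × Bool), ∑ j ∈ insert i s, a j * e' j p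
        = a i * (if p.2 then 1 else -1) + ∑ j ∈ s, a j * e j p.1 := by
      intro a p
      rw [Finset.sum_insert hi]
      congr 1
      · simp [e']
      · refine Finset.sum_congr rfl fun j hj => ?_
        have : j ≠ i := fun h => hi (h ▸ hj)
        simp [e', this]
    refine ⟨Ω × Bool, inferInstance, inferInstance, e', fun a c => ?_, fun a => ?_⟩
    · simp only [hs, Fintype.sum_prod_type, Fintype.sum_bool, Finset.sum_insert hi,
        Fintype.card_prod, Fintype.card_bool, Nat.cast_mul, if_true]
      have := h2 a c
      calc _ = ∑ ω, (2 * (a i * c i) + 2 * ((∑ j ∈ s, a j * e j ω) * ∑ j ∈ s, c j * e j ω)) := by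
            refine Finset.sum_congr rfl fun ω _ => ?_
            simp; ring
        _ = _ := by
            rw [Finset.sum_add_distrib, Finset.sum_const, ← Finset.mul_sum, this, Finset.card_univ,
              nsmul_eq_mul]
            push_cast; ring
    · simp only [hs, Fintype.sum_prod_type, Fintype.sum_bool, Finset.sum_insert hi,
        Fintype.card_prod, Fintype.card_bool, Nat.cast_mul, if_true]
      have h2a : ∑ ω, (∑ j ∈ s, a j * e j ω) ^ 2 = Fintype.card Ω * ∑ j ∈ s, a j ^ 2 := by
        simpa only [sq] using h2 a a
      have h4a := h4 a
      calc _ = ∑ ω, (2 * a i ^ 4 + 12 * a i ^ 2 * (∑ j ∈ s, a j * e j ω) ^ 2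
              + 2 * (∑ j ∈ s, a j * e j ω) ^ 4) := by
            refine Finset.sum_congr rfl fun ω _ => ?_
            simp; ring
        _ = 2 * Fintype.card Ω * a i ^ 4 + 12 * a i ^ 2 * (Fintype.card Ω * ∑ j ∈ s, a j ^ 2)
              + 2 * ∑ ω, (∑ j ∈ s, a j * e j ω) ^ 4 := by
            rw [Finset.sum_add_distrib, Finset.sum_add_distrib, ← Finset.mul_sum, ← Finset.mul_sum,
              h2a, ← Finset.mul_sum, Finset.sum_const, Finset.card_univ, nsmul_eq_mul]
            ring
        _ ≤ _ := by
            have : 0 ≤ (Fintype.card Ω : ℝ) * a i ^ 4 := by positivity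
            push_cast
            nlinarith

variable {m n : Type*} [Fintype m] [Fintype n]

/-- The pairing of a matrix with the off-diagonal block of a Gram matrix. -/
def gramPairing (A : Matrix m n ℝ) (G : Matrix (m ⊕ n) (m ⊕ n) ℝ) : ℝ :=
  ∑ i, ∑ j, A i j * G (Sum.inl i) (Sum.inr j)

theorem exists_max_gramPairing [DecidableEq m] [DecidableEq n] (A : Matrix m n ℝ) :
    ∃ G : Matrix (m ⊕ n) (m ⊕ n) ℝ, (G.PosSemidef ∧ ∀ p, G p p ≤ 1) ∧
      ∀ H : Matrix (m ⊕ n) (m ⊕ n) ℝ, H.PosSemidef → (∀ p, H p p ≤ 1) →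
        gramPairing A H ≤ gramPairing A G := by
  let S : Set (Matrix (m ⊕ n) (m ⊕ n) ℝ) := {M | ∀ p, (Mᴴ * M) p p ≤ 1}
  have hdiag : ∀ (M : Matrix (m ⊕ n) (m ⊕ n) ℝ) p, (Mᴴ * M) p p = ∑ q, M q p ^ 2 := by
    intro M p
    simp [Matrix.mul_apply, sq]
  have hS : IsCompact S := by
    have hK : IsCompact (Set.univ.pi fun _ : m ⊕ n => Set.univ.pi fun _ : m ⊕ n =>
        Set.Icc (-1 : ℝ) 1) :=
      isCompact_univ_pi fun _ => isCompact_univ_pi fun _ => isCompact_Icc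
    refine hK.of_isClosed_subset ?_ ?_
    · have : S = ⋂ p, {M | (Mᴴ * M) p p ≤ 1} := by ext; simp [S]
      rw [this]
      refine isClosed_iInter fun p => isClosed_le ?_ continuous_const
      exact (continuous_id.matrix_conjTranspose.matrix_mul continuous_id).matrix_elem p p
    · intro (M : Matrix _ _ ℝ) hM q _ p _
      have h1 := hM p
      replace h1 := (hdiag M p).symm.le.trans h1
      have h2 : M q p ^ 2 ≤ ∑ q, M q p ^ 2 :=
        Finset.single_le_sum (f := fun q => M q p ^ 2) (fun _ _ => sq_nonneg _) (Finset.mem_univ q)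
      exact abs_le.mp ((sq_le_one_iff_abs_le_one _).mp (h2.trans h1))
  have hc : Continuous fun M : Matrix (m ⊕ n) (m ⊕ n) ℝ => gramPairing A (Mᴴ * M) := by
    unfold gramPairing
    refine continuous_finsetSum _ fun i _ => continuous_finsetSum _ fun j _ =>
      continuous_const.mul ?_
    exact (continuous_id.matrix_conjTranspose.matrix_mul continuous_id).matrix_elem _ _
  obtain ⟨M, hM, hmax⟩ := hS.exists_isMaxOn ⟨0, by simp [S]⟩ hc.continuousOn
  refine ⟨Mᴴ * M, ⟨posSemidef_conjTranspose_mul_self M, hM⟩, fun H hH hH1 => ?_⟩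
  obtain ⟨L, rfl⟩ := CStarAlgebra.nonneg_iff_eq_star_mul_self.mp hH.nonneg
  exact hmax hH1

theorem gramPairing_smul (A : Matrix m n ℝ) (c : ℝ) (G : Matrix (m ⊕ n) (m ⊕ n) ℝ) :
    gramPairing A (c • G) = c * gramPairing A G := by
  simp only [gramPairing, Finset.mul_sum, Matrix.smul_apply, smul_eq_mul]
  exact Finset.sum_congr rfl fun i _ => Finset.sum_congr rfl fun j _ => by ring

/-- Homogeneous form of a bound on Gram matrices with diagonal at most `1`. -/
theorem gramPairing_le_mul {A : Matrix m n ℝ} {γ c : ℝ}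
    (hγ : ∀ H : Matrix (m ⊕ n) (m ⊕ n) ℝ, H.PosSemidef → (∀ p, H p p ≤ 1) → gramPairing A H ≤ γ)
    (hc : 0 ≤ c) {G : Matrix (m ⊕ n) (m ⊕ n) ℝ} (hG : G.PosSemidef) (hG1 : ∀ p, G p p ≤ c) :
    gramPairing A G ≤ c * γ := by
  have hpos : ∀ b, c < b → gramPairing A G ≤ b * γ := fun b hb => by
    have hb0 := hc.trans_lt hb
    have h := hγ (b⁻¹ • G) (hG.smul (by positivity)) fun p => by
      rw [Matrix.smul_apply, smul_eq_mul, inv_mul_le_iff₀ hb0, mul_one]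
      exact (hG1 p).trans hb.le
    rwa [gramPairing_smul, inv_mul_le_iff₀ hb0] at h
  have hlim : Tendsto (fun b : ℝ => b * γ) (nhdsWithin c (Set.Ioi c)) (nhds (c * γ)) :=
    ((continuous_id.mul continuous_const).tendsto c).mono_left nhdsWithin_le_nhds
  exact ge_of_tendsto hlim (eventually_mem_nhdsWithin.mono hpos)

theorem sum_gramPairing_le {A : Matrix m n ℝ} {γ c : ℝ}
    (hγ : ∀ H : Matrix (m ⊕ n) (m ⊕ n) ℝ, H.PosSemidef → (∀ p, H p p ≤ 1) → gramPairing A H ≤ γ)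
    (hc : 0 ≤ c) {Ω : Type*} [Fintype Ω] (X : m → Ω → ℝ) (Y : n → Ω → ℝ)
    (hX : ∀ i, ∑ ω, X i ω ^ 2 ≤ c) (hY : ∀ j, ∑ ω, Y j ω ^ 2 ≤ c) :
    ∑ i, ∑ j, A i j * ∑ ω, X i ω * Y j ω ≤ c * γ := by
  let Z : Matrix (m ⊕ n) Ω ℝ := Matrix.of (Sum.elim X Y)
  have h := gramPairing_le_mul hγ hc (posSemidef_self_mul_conjTranspose Z) (by
    rintro (i | j)
    · simpa [Z, Matrix.mul_apply, sq] using hX i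
    · simpa [Z, Matrix.mul_apply, sq] using hY j)
  simpa [gramPairing, Z, Matrix.mul_apply] using h

/-- Truncation of a real number to `[-2, 2]`. -/
noncomputable def clipTwo (x : ℝ) : ℝ := max (-2) (min 2 x)

theorem abs_clipTwo_le (x : ℝ) : |clipTwo x| ≤ 2 :=
  abs_le.mpr ⟨le_max_left _ _, max_le (by norm_num) (min_le_left _ _)⟩

theorem clipTwo_sq_le (x : ℝ) : clipTwo x ^ 2 ≤ x ^ 2 := by
  unfold clipTwo
  rcases max_cases (-2) (min 2 x) with h | h <;> rcases min_cases 2 x with h' | h' <;> nlinarith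

theorem sub_clipTwo_sq_le (x : ℝ) : (4 * (x - clipTwo x)) ^ 2 ≤ x ^ 4 / 4 := by
  have key : |8 * (x - clipTwo x)| ≤ x ^ 2 := by
    unfold clipTwo
    rcases max_cases (-2) (min 2 x) with h | h <;> rcases min_cases 2 x with h' | h' <;>
      rw [abs_le] <;> constructor <;> nlinarith [sq_nonneg (x - 4), sq_nonneg (x + 4)]
  have := sq_le_sq' (abs_le.mp key).1 (abs_le.mp key).2
  nlinarith

/-- **Grothendieck's inequality**, with constant `8`. -/
theorem gramPairing_le_of_bilin_le {A : Matrix m n ℝ} {N : ℝ}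
    (hN : ∀ (y : m → ℝ) (x : n → ℝ), (∀ i, |y i| ≤ 1) → (∀ j, |x j| ≤ 1) →
      ∑ i, ∑ j, A i j * (y i * x j) ≤ N)
    {H : Matrix (m ⊕ n) (m ⊕ n) ℝ} (hH : H.PosSemidef) (hH1 : ∀ p, H p p ≤ 1) :
    gramPairing A H ≤ 8 * N := by
  classical
  obtain ⟨G, ⟨hG, hG1⟩, hmax⟩ := exists_max_gramPairing A
  refine (hmax H hH hH1).trans ?_
  obtain ⟨M, hM⟩ := CStarAlgebra.nonneg_iff_eq_star_mul_self.mp hG.nonneg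
  have hGM : ∀ p q, G p q = ∑ r, M r p * M r q := fun p q => by
    rw [hM]; simp [Matrix.mul_apply, Matrix.star_eq_conjTranspose]
  obtain ⟨Ω, _, _, e, h2, h4⟩ := exists_orthonormal_fourth_moment_le (Finset.univ : Finset (m ⊕ n))
  set c : ℝ := (Fintype.card Ω : ℝ)
  have hc : 0 < c := Nat.cast_pos.mpr Fintype.card_pos
  let X : m ⊕ n → Ω → ℝ := fun p ω => ∑ r, M r p * e r ω
  have hXX : ∀ p q, ∑ ω, X p ω * X q ω = c * G p q := fun p q => by
    rw [hGM]; exact h2 _ _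
  have hX2 : ∀ p, ∑ ω, X p ω ^ 2 ≤ c := fun p => by
    simp only [sq, hXX]
    nlinarith [hG1 p]
  have hX4 : ∀ p, ∑ ω, X p ω ^ 4 ≤ 3 * c := fun p => by
    refine (h4 fun r => M r p).trans ?_
    have h : ∑ r, M r p ^ 2 ≤ 1 := by simpa [hGM, sq] using hG1 p
    have h0 : 0 ≤ ∑ r, M r p ^ 2 := Finset.sum_nonneg fun _ _ => sq_nonneg _
    have : (∑ r, M r p ^ 2) ^ 2 ≤ 1 := pow_le_one₀ h0 h
    nlinarith
  let T : m ⊕ n → Ω → ℝ := fun p ω => clipTwo (X p ω)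
  let R : m ⊕ n → Ω → ℝ := fun p ω => 4 * (X p ω - T p ω)
  have hT : ∀ p, ∑ ω, T p ω ^ 2 ≤ c := fun p =>
    (Finset.sum_le_sum fun ω _ => clipTwo_sq_le _).trans (hX2 p)
  have hR : ∀ p, ∑ ω, R p ω ^ 2 ≤ c := fun p => by
    refine (Finset.sum_le_sum fun ω _ => sub_clipTwo_sq_le (X p ω)).trans ?_
    rw [← Finset.sum_div]
    linarith [hX4 p]
  have hTR := sum_gramPairing_le hmax hc.le (fun i => T (.inl i)) (fun j => R (.inr j))
    (fun i => hT _) (fun j => hR _)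
  have hRX := sum_gramPairing_le hmax hc.le (fun i => R (.inl i)) (fun j => X (.inr j))
    (fun i => hR _) (fun j => hX2 _)
  have hTT : ∑ i, ∑ j, A i j * ∑ ω, T (.inl i) ω * T (.inr j) ω ≤ c * (4 * N) := by
    have hω : ∀ ω, ∑ i, ∑ j, A i j * (T (.inl i) ω * T (.inr j) ω) ≤ 4 * N := fun ω => by
      have hb : ∀ p, |T p ω / 2| ≤ 1 := fun p => by
        rw [abs_div, abs_two, div_le_one two_pos]
        exact abs_clipTwo_le _
      have h := hN (fun i => T (.inl i) ω / 2) (fun j => T (.inr j) ω / 2)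
        (fun i => hb _) (fun j => hb _)
      calc _ = 4 * ∑ i, ∑ j, A i j * (T (.inl i) ω / 2 * (T (.inr j) ω / 2)) := by
            simp only [Finset.mul_sum]
            exact Finset.sum_congr rfl fun i _ => Finset.sum_congr rfl fun j _ => by ring
        _ ≤ _ := by linarith
    calc _ = ∑ ω, ∑ i, ∑ j, A i j * (T (.inl i) ω * T (.inr j) ω) := by
          simp only [Finset.mul_sum]
          rw [Finset.sum_comm]
          simp_rw [Finset.sum_comm (s := (Finset.univ : Finset m)) (t := (Finset.univ : Finset Ω))]
          rw [Finset.sum_comm]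
          exact Finset.sum_congr rfl fun ω _ => Finset.sum_comm
      _ ≤ ∑ _ω : Ω, 4 * N := Finset.sum_le_sum fun ω _ => hω ω
      _ = _ := by simp [c]
  have hsplit : c * gramPairing A G
      = ∑ i, ∑ j, A i j * ∑ ω, T (.inl i) ω * T (.inr j) ω
        + 1 / 4 * ∑ i, ∑ j, A i j * ∑ ω, T (.inl i) ω * R (.inr j) ω
        + 1 / 4 * ∑ i, ∑ j, A i j * ∑ ω, R (.inl i) ω * X (.inr j) ω := by
    simp only [gramPairing, Finset.mul_sum, ← Finset.sum_add_distrib]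
    refine Finset.sum_congr rfl fun i _ => Finset.sum_congr rfl fun j _ => ?_
    rw [mul_left_comm, ← hXX, Finset.mul_sum]
    refine Finset.sum_congr rfl fun ω _ => ?_
    simp only [R]
    ring
  have : c * gramPairing A G ≤ c * (8 * N) := by linarith
  exact le_of_mul_le_mul_left this hc

/-- Second-order optimality at a maximizing Gram matrix: a factorization of the bilinear form of `A`
through weighted Hilbert spaces. -/
theorem exists_weights_bilin_le {A : Matrix m n ℝ} {γ : ℝ}
    (hγ : ∀ H : Matrix (m ⊕ n) (m ⊕ n) ℝ, H.PosSemidef → (∀ p, H p p ≤ 1) → gramPairing A H ≤ γ) :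
    ∃ (u : m → ℝ) (v : n → ℝ), (∀ i, 0 ≤ u i) ∧ (∀ j, 0 ≤ v j) ∧ ∑ i, u i ≤ γ ∧ ∑ j, v j ≤ γ ∧
      ∀ (s : m → ℝ) (r : n → ℝ),
        ∑ i, ∑ j, A i j * (s i * r j) ≤ ∑ i, u i * s i ^ 2 + ∑ j, v j * r j ^ 2 := by
  classical
  obtain ⟨G, ⟨hG, hG1⟩, hmax⟩ := exists_max_gramPairing A
  let u : m → ℝ := fun i => ∑ j, A i j * G (.inl i) (.inr j)
  let v : n → ℝ := fun j => ∑ i, A i j * G (.inl i) (.inr j)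
  have key : ∀ (s : m → ℝ) (r : n → ℝ),
      ∑ i, ∑ j, A i j * (s i * r j) ≤ ∑ i, u i * s i ^ 2 + ∑ j, v j * r j ^ 2 := by
    intro s r
    let w : m ⊕ n → ℝ := Sum.elim s r
    set Q := ∑ i, ∑ j, A i j * (s i ^ 2 * r j ^ 2 * G (.inl i) (.inr j)) with hQ
    set P := ∑ i, ∑ j, A i j * (s i * r j) with hP
    set L := ∑ i, u i * s i ^ 2 + ∑ j, v j * r j ^ 2 with hL
    have hL' : L = ∑ i, ∑ j, A i j * ((s i ^ 2 + r j ^ 2) * G (.inl i) (.inr j)) := by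
      simp only [hL, u, v, Finset.sum_mul]
      rw [Finset.sum_comm (s := (Finset.univ : Finset n))]
      simp only [← Finset.sum_add_distrib]
      exact Finset.sum_congr rfl fun i _ => Finset.sum_congr rfl fun j _ => by ring
    have hvar : ∀ τ : ℝ, 0 ≤ τ → (∀ p, τ * w p ^ 2 ≤ 1) → τ * (P - L + τ * Q) ≤ 0 := by
      intro τ hτ hw
      let D : Matrix (m ⊕ n) (m ⊕ n) ℝ := Matrix.diagonal fun p => 1 - τ * w p ^ 2
      let H := Dᴴ * G * D + τ • Matrix.vecMulVec w (star w)
      have happ : ∀ p q, H p q = (1 - τ * w p ^ 2) * (1 - τ * w q ^ 2) * G p q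
          + τ * (w p * w q) := fun p q => by
        simp [H, D, Matrix.vecMulVec_apply]
        ring
      have hH : H.PosSemidef := (hG.conjTranspose_mul_mul_same D).add
        ((posSemidef_vecMulVec_self_star w).smul hτ)
      have hH1 : ∀ p, H p p ≤ 1 := fun p => by
        rw [happ]
        have h0 : 0 ≤ τ * w p ^ 2 := by positivity
        have h1 := hw p
        nlinarith [mul_nonneg (sq_nonneg (1 - τ * w p ^ 2)) (sub_nonneg.mpr (hG1 p))]
      have h := hmax H hH hH1
      have hexp : gramPairing A H = gramPairing A G + τ * (P - L + τ * Q) := by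
        rw [hL', hP, hQ]
        simp only [gramPairing, happ, Finset.mul_sum, ← Finset.sum_add_distrib,
          ← Finset.sum_sub_distrib]
        refine Finset.sum_congr rfl fun i _ => Finset.sum_congr rfl fun j _ => ?_
        simp only [w, Sum.elim_inl, Sum.elim_inr]
        ring
      linarith
    by_contra! hlt
    set W := ∑ p, w p ^ 2 with hW
    have hW0 : 0 ≤ W := Finset.sum_nonneg fun _ _ => sq_nonneg _
    set τ := min (1 / (1 + W)) ((P - L) / (2 * (1 + |Q|))) with hτ
    have hPL : 0 < P - L := by linarith
    have hτ0 : 0 < τ := lt_min (by positivity) (by positivity)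
    have h1 := hvar τ hτ0.le fun p => by
      have hp : w p ^ 2 ≤ W :=
        Finset.single_le_sum (f := fun p => w p ^ 2) (fun _ _ => sq_nonneg _) (Finset.mem_univ p)
      have : τ * (1 + W) ≤ 1 := (le_div_iff₀ (by positivity)).mp (min_le_left _ _)
      nlinarith
    have h2 : τ * (2 * (1 + |Q|)) ≤ P - L := (le_div_iff₀ (by positivity)).mp (min_le_right _ _)
    have h3 : P - L + τ * Q ≤ 0 := nonpos_of_mul_nonpos_right h1 hτ0
    nlinarith [neg_abs_le Q, abs_nonneg Q]
  refine ⟨u, v, fun i => ?_, fun j => ?_, hγ G hG hG1, ?_, key⟩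
  · simpa [Pi.single_apply, ite_pow] using key (Pi.single i 1) 0
  · simpa [Pi.single_apply, ite_pow] using key 0 (Pi.single j 1)
  · rw [Finset.sum_comm]
    exact hγ G hG hG1

theorem sum_mul_weight_mul_le {a b : m → ℝ} (ha : ∀ k, 0 ≤ a k) (hb : ∀ k, |b k| ≤ 1) :
    ∑ k, b k * (2 * a k) * b k ≤ 2 * ∑ k, a k := by
  rw [Finset.mul_sum]
  refine Finset.sum_le_sum fun k _ => ?_
  nlinarith [ha k, mul_nonneg (ha k) (sub_nonneg.mpr ((sq_le_one_iff_abs_le_one _).mpr (hb k)))]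

/-- Grothendieck bounds on Gram matrices are, up to a factor `2`, multiplicative under tensor
products. -/
theorem tensor_bilin_le {m' n' : Type*} [Fintype m'] [Fintype n']
    {A : Matrix m n ℝ} {B : Matrix m' n' ℝ} {α β : ℝ}
    (hA : ∀ H : Matrix (m ⊕ n) (m ⊕ n) ℝ, H.PosSemidef → (∀ p, H p p ≤ 1) → gramPairing A H ≤ α)
    (hB : ∀ H : Matrix (m' ⊕ n') (m' ⊕ n') ℝ, H.PosSemidef → (∀ p, H p p ≤ 1) →
      gramPairing B H ≤ β)
    (y : m → m' → ℝ) (x : n → n' → ℝ) (hy : ∀ i k, |y i k| ≤ 1) (hx : ∀ j l, |x j l| ≤ 1) :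
    ∑ i, ∑ j, A i j * ∑ k, ∑ l, B k l * (y i k * x j l) ≤ 2 * α * β := by
  classical
  obtain ⟨u, v, hu, hv, hus, hvs, huv⟩ := exists_weights_bilin_le hB
  let P : Matrix (m' ⊕ n') (m' ⊕ n') ℝ :=
    Matrix.fromBlocks (Matrix.diagonal fun k => 2 * u k) B Bᵀ (Matrix.diagonal fun l => 2 * v l)
  have hP : P.PosSemidef := by
    refine PosSemidef.of_dotProduct_mulVec_nonneg ?_ fun w => ?_
    · exact (isHermitian_diagonal _).fromBlocks (conjTranspose_eq_transpose_of_trivial B)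
        (isHermitian_diagonal _)
    · have h := huv (fun k => -w (.inl k)) (fun l => w (.inr l))
      have hw : star w ⬝ᵥ P *ᵥ w = 2 * (∑ k, u k * w (.inl k) ^ 2 + ∑ l, v l * w (.inr l) ^ 2)
          + 2 * ∑ k, ∑ l, B k l * (w (.inl k) * w (.inr l)) := by
        have hl : ∀ k, (P *ᵥ w) (.inl k) = 2 * u k * w (.inl k) + ∑ l, B k l * w (.inr l) :=
          fun k => by simp [P, mulVec, dotProduct, Fintype.sum_sum_type, Matrix.diagonal_apply]
        have hr : ∀ l, (P *ᵥ w) (.inr l) = ∑ k, B k l * w (.inl k) + 2 * v l * w (.inr l) :=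
          fun l => by simp [P, mulVec, dotProduct, Fintype.sum_sum_type, Matrix.diagonal_apply]
        have hcomm : ∑ l, w (.inr l) * ∑ k, B k l * w (.inl k)
            = ∑ k, ∑ l, B k l * (w (.inl k) * w (.inr l)) := by
          simp only [Finset.mul_sum]
          rw [Finset.sum_comm]
          exact Finset.sum_congr rfl fun k _ => Finset.sum_congr rfl fun l _ => by ring
        have hcomm' : ∑ k, w (.inl k) * ∑ l, B k l * w (.inr l)
            = ∑ k, ∑ l, B k l * (w (.inl k) * w (.inr l)) := by
          simp only [Finset.mul_sum]
          exact Finset.sum_congr rfl fun k _ => Finset.sum_congr rfl fun l _ => by ring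
        have hu2 : ∑ k, w (.inl k) * (2 * u k * w (.inl k)) = 2 * ∑ k, u k * w (.inl k) ^ 2 := by
          rw [Finset.mul_sum]
          exact Finset.sum_congr rfl fun k _ => by ring
        have hv2 : ∑ l, w (.inr l) * (2 * v l * w (.inr l)) = 2 * ∑ l, v l * w (.inr l) ^ 2 := by
          rw [Finset.mul_sum]
          exact Finset.sum_congr rfl fun l _ => by ring
        simp only [dotProduct, Fintype.sum_sum_type, Pi.star_apply, star_trivial, hl, hr, mul_add,
          Finset.sum_add_distrib, hcomm, hcomm', hu2, hv2]
        ring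
      rw [hw]
      simp only [neg_mul, mul_neg, Finset.sum_neg_distrib, neg_sq] at h
      linarith
  let Z : Matrix (m' ⊕ n') (m ⊕ n) ℝ :=
    Matrix.fromBlocks (Matrix.of y)ᵀ 0 0 (Matrix.of x)ᵀ
  have hZ : Zᴴ * P * Z = Matrix.fromBlocks
      (Matrix.of y * Matrix.diagonal (fun k => 2 * u k) * (Matrix.of y)ᵀ)
      (Matrix.of y * B * (Matrix.of x)ᵀ) (Matrix.of x * Bᵀ * (Matrix.of y)ᵀ)
      (Matrix.of x * Matrix.diagonal (fun l => 2 * v l) * (Matrix.of x)ᵀ) := by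
    simp only [Z, P]
    rw [fromBlocks_conjTranspose, fromBlocks_multiply, fromBlocks_multiply]
    simp [conjTranspose_eq_transpose_of_trivial]
  have hβ : 0 ≤ β := (Finset.sum_nonneg fun k _ => hu k).trans hus
  have h := gramPairing_le_mul hA (c := 2 * β) (by positivity)
    (hP.conjTranspose_mul_mul_same Z) (by
      rw [hZ]
      rintro (i | j)
      · simpa only [fromBlocks_apply₁₁, Matrix.mul_apply (M := _ * _), Matrix.mul_diagonal,
          Matrix.transpose_apply, Matrix.of_apply] using
          (sum_mul_weight_mul_le hu (hy i)).trans
            (mul_le_mul_of_nonneg_left hus zero_le_two)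
      · simpa only [fromBlocks_apply₂₂, Matrix.mul_apply (M := _ * _), Matrix.mul_diagonal,
          Matrix.transpose_apply, Matrix.of_apply] using
          (sum_mul_weight_mul_le hv (hx j)).trans
            (mul_le_mul_of_nonneg_left hvs zero_le_two))
  rw [hZ] at h
  calc _ = _ := by
        simp only [gramPairing, fromBlocks_apply₁₂]
        refine Finset.sum_congr rfl fun i _ => Finset.sum_congr rfl fun j _ => ?_
        congr 1
        simp only [Matrix.mul_apply, Matrix.transpose_apply, Matrix.of_apply, Finset.sum_mul]
        rw [Finset.sum_comm]
        exact Finset.sum_congr rfl fun l _ => Finset.sum_congr rfl fun k _ => by ring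
    _ ≤ _ := h
    _ = _ := by ring

end Grothendieck

theorem bilin_le_normInfOne {n : ℕ} (A : Matrix (Fin n) (Fin n) ℝ) (y x : Fin n → ℝ)
    (hy : ∀ i, |y i| ≤ 1) (hx : ∀ j, |x j| ≤ 1) :
    ∑ i, ∑ j, A i j * (y i * x j) ≤ normInfOne A := by
  have hbdd : BddAbove {r : ℝ | ∃ x : Fin n → ℝ, (∀ j, |x j| ≤ 1) ∧
      r = ∑ i, |∑ j, A i j * x j|} := by
    refine ⟨∑ i, ∑ j, |A i j|, ?_⟩
    rintro _ ⟨x, hx, rfl⟩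
    refine Finset.sum_le_sum fun i _ => (Finset.abs_sum_le_sum_abs _ _).trans ?_
    refine Finset.sum_le_sum fun j _ => ?_
    rw [abs_mul]
    exact mul_le_of_le_one_right (abs_nonneg _) (hx j)
  refine le_trans ?_ (le_csSup hbdd ⟨x, hx, rfl⟩)
  refine Finset.sum_le_sum fun i _ => ?_
  calc ∑ j, A i j * (y i * x j) = y i * ∑ j, A i j * x j := by
        rw [Finset.mul_sum]
        exact Finset.sum_congr rfl fun j _ => by ring
    _ ≤ |y i * ∑ j, A i j * x j| := le_abs_self _
    _ ≤ _ := by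
        rw [abs_mul]
        exact mul_le_of_le_one_left (abs_nonneg _) (hy i)

theorem normInfOne_le_of_bilin_le {n : ℕ} {A : Matrix (Fin n) (Fin n) ℝ} {c : ℝ}
    (h : ∀ y x : Fin n → ℝ, (∀ i, |y i| ≤ 1) → (∀ j, |x j| ≤ 1) →
      ∑ i, ∑ j, A i j * (y i * x j) ≤ c) : normInfOne A ≤ c := by
  refine csSup_le ⟨_, 0, by simp, rfl⟩ ?_
  rintro _ ⟨x, hx, rfl⟩
  refine le_of_eq_of_le ?_ (h (fun i => SignType.sign (∑ j, A i j * x j)) x (fun i => ?_) hx)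
  · refine Finset.sum_congr rfl fun i _ => ?_
    rw [← sign_mul_self, Finset.mul_sum]
    exact Finset.sum_congr rfl fun j _ => by ring
  · rcases SignType.sign (∑ j, A i j * x j) with _ | _ | _ <;> simp

/-- There is a constant `C > 0` (in the paper, `(π/2)·K_G²`) such that
for every `n` and all `n × n` real matrices `A, B`,
`‖A ⊗ B‖_{B(ℓ∞,ℓ¹)} ≤ C·‖A‖_{B(ℓ∞,ℓ¹)}·‖B‖_{B(ℓ∞,ℓ¹)}`. -/
theorem normInfOne_kron_le :
    ∃ C : ℝ, 0 < C ∧ ∀ (n : ℕ) (A B : Matrix (Fin n) (Fin n) ℝ),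
      normInfOne (kron A B) ≤ C * normInfOne A * normInfOne B := by
  refine ⟨128, by norm_num, fun n A B => normInfOne_le_of_bilin_le fun y x hy hx => ?_⟩
  have h := tensor_bilin_le
    (fun _ => gramPairing_le_of_bilin_le (bilin_le_normInfOne A))
    (fun _ => gramPairing_le_of_bilin_le (bilin_le_normInfOne B))
    (fun i k => y (finProdFinEquiv (i, k))) (fun j l => x (finProdFinEquiv (j, l)))
    (fun _ _ => hy _) (fun _ _ => hx _)
  calc _ = ∑ i, ∑ j, A i j * ∑ k, ∑ l, B k l *
        (y (finProdFinEquiv (i, k)) * x (finProdFinEquiv (j, l))) := by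
        rw [← finProdFinEquiv.sum_comp, Fintype.sum_prod_type]
        simp_rw [← finProdFinEquiv.sum_comp, Fintype.sum_prod_type, Finset.mul_sum]
        refine Finset.sum_congr rfl fun i _ => ?_
        rw [Finset.sum_comm]
        refine Finset.sum_congr rfl fun j _ => Finset.sum_congr rfl fun k _ =>
          Finset.sum_congr rfl fun l _ => ?_
        simp [kron, mul_assoc]
    _ ≤ _ := h
    _ = _ := by ring
end

section
/- The supremum over all nonzero n × n real matrices A of the ratio ‖𝒯_n(A)‖_□ / ‖A‖_□ tends to infinity as n → ∞. Equivalently, for every c > 0 there exists n and an n × n real matrix A with ‖A‖_□ ≠ 0 and ‖𝒯_n(A)‖_□ > c·‖A‖_□. -/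
open MeasureTheory Filter

/-- Cut norm of an `n × n` real matrix:
`(1/n²) · sup_{S,T ⊆ [n]} |∑_{i∈S, j∈T} a_ij|`. -/
noncomputable def cutNorm {n : ℕ} (A : Matrix (Fin n) (Fin n) ℝ) : ℝ :=
  (1 / (n : ℝ) ^ 2) * sSup {r : ℝ | ∃ S T : Finset (Fin n), r = |∑ i ∈ S, ∑ j ∈ T, A i j|}
/-- Triangular cut `𝒯_n(A) = A ∘ T_n`, where `(T_n)_{ij} = 1` if `i ≥ j` and `0` if `i < j`:
entries with `i < j` are set to zero. -/
def tri {n : ℕ} (A : Matrix (Fin n) (Fin n) ℝ) : Matrix (Fin n) (Fin n) ℝ :=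
  fun i j => if j ≤ i then A i j else 0

open Real in
lemma integral_sub_mul_sin (k : ℤ) :
    ∫ t in (0 : ℝ)..2 * π, (π - t) * sin (k * t) = 2 * π * (k : ℝ)⁻¹ := by
  rcases eq_or_ne k 0 with rfl | hk
  · simp
  have hk' : (k : ℝ) ≠ 0 := by exact_mod_cast hk
  have hderiv : ∀ t ∈ Set.uIcc (0 : ℝ) (2 * π),
      HasDerivAt (fun t : ℝ => -((π - t) * cos (k * t) / k) - sin (k * t) / (k : ℝ) ^ 2)
        ((π - t) * sin (k * t)) t := by
    intro t _
    have hlin : HasDerivAt (fun t : ℝ => (k : ℝ) * t) k t := by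
      simpa using (hasDerivAt_id t).const_mul (k : ℝ)
    have hsub : HasDerivAt (fun t : ℝ => π - t) (-1) t := by
      simpa using (hasDerivAt_id t).const_sub π
    refine HasDerivAt.congr_deriv
      (((hsub.mul hlin.cos).div_const (k : ℝ)).neg.sub (hlin.sin.div_const ((k : ℝ) ^ 2))) ?_
    field_simp
    ring
  rw [intervalIntegral.integral_eq_sub_of_hasDerivAt hderiv
    (Continuous.intervalIntegrable (by fun_prop) _ _)]
  have hcos : cos (k * (2 * π)) = 1 := cos_int_mul_two_pi k
  have hsin : sin (k * (2 * π)) = 0 := by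
    simpa using sin_add_int_mul_two_pi 0 k
  rw [hcos, hsin]
  simp
  field_simp
  ring

open Real in
lemma integral_cos_int_mul (k : ℤ) :
    ∫ t in (0 : ℝ)..2 * π, cos (k * t) = if k = 0 then 2 * π else 0 := by
  split_ifs with hk
  · simp [hk]
  have hk' : (k : ℝ) ≠ 0 := by exact_mod_cast hk
  have hsin : sin (k * (2 * π)) = 0 := by
    simpa using sin_add_int_mul_two_pi 0 k
  rw [intervalIntegral.integral_comp_mul_left _ hk', integral_cos, hsin]
  simp

open Real in
/-- Parseval's identity for the trigonometric polynomial with frequencies `S`. -/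
lemma integral_sum_cos_sub {n : ℕ} (S : Finset (Fin n)) :
    ∫ t in (0 : ℝ)..2 * π, ∑ i ∈ S, ∑ j ∈ S, cos ((((i : ℤ) - (j : ℤ) : ℤ) : ℝ) * t)
      = 2 * π * S.card := by
  rw [intervalIntegral.integral_finsetSum
    (fun i _ => Continuous.intervalIntegrable (by fun_prop) _ _)]
  have hrow : ∀ i ∈ S, ∫ t in (0 : ℝ)..2 * π,
      ∑ j ∈ S, cos ((((i : ℤ) - (j : ℤ) : ℤ) : ℝ) * t) = 2 * π := by
    intro i hi
    rw [intervalIntegral.integral_finsetSum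
      (fun j _ => Continuous.intervalIntegrable (by fun_prop) _ _)]
    simp_rw [integral_cos_int_mul]
    have heq : ∀ j : Fin n, ((i : ℤ) - (j : ℤ) = 0) ↔ i = j := by
      intro j
      rw [Fin.ext_iff]
      omega
    simp_rw [heq]
    simp [hi]
  rw [Finset.sum_congr rfl hrow]
  simp [mul_comm]

open Real in
lemma abs_sum_sin_sub_le {n : ℕ} (S T : Finset (Fin n)) (t : ℝ) :
    |∑ i ∈ S, ∑ j ∈ T, sin ((((i : ℤ) - (j : ℤ) : ℤ) : ℝ) * t)|
      ≤ ((∑ i ∈ S, ∑ j ∈ S, cos ((((i : ℤ) - (j : ℤ) : ℤ) : ℝ) * t))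
        + ∑ i ∈ T, ∑ j ∈ T, cos ((((i : ℤ) - (j : ℤ) : ℤ) : ℝ) * t)) / 2 := by
  have hsin : ∑ i ∈ S, ∑ j ∈ T, sin ((((i : ℤ) - (j : ℤ) : ℤ) : ℝ) * t)
      = (∑ i ∈ S, sin (i * t)) * (∑ j ∈ T, cos (j * t))
        - (∑ i ∈ S, cos (i * t)) * (∑ j ∈ T, sin (j * t)) := by
    simp [Finset.sum_mul_sum, sub_mul, sin_sub]
  have hcos : ∀ U : Finset (Fin n),
      ∑ i ∈ U, ∑ j ∈ U, cos ((((i : ℤ) - (j : ℤ) : ℤ) : ℝ) * t)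
        = (∑ i ∈ U, cos (i * t)) ^ 2 + (∑ i ∈ U, sin (i * t)) ^ 2 := by
    intro U
    simp [sq, Finset.sum_mul_sum, sub_mul, cos_sub, Finset.sum_add_distrib]
  rw [hsin, hcos, hcos]
  generalize ∑ i ∈ S, sin ((i : ℝ) * t) = a
  generalize ∑ i ∈ T, cos ((i : ℝ) * t) = b
  generalize ∑ i ∈ S, cos ((i : ℝ) * t) = c
  generalize ∑ i ∈ T, sin ((i : ℝ) * t) = d
  rw [abs_le]
  constructor <;> nlinarith [sq_nonneg (a - b), sq_nonneg (a + b), sq_nonneg (c - d),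
    sq_nonneg (c + d)]

/-- The discrete Hilbert matrix, with zero diagonal. -/
noncomputable def hilbertMatrix (n : ℕ) : Matrix (Fin n) (Fin n) ℝ :=
  fun i j => (((i : ℤ) - (j : ℤ) : ℤ) : ℝ)⁻¹

open Real in
/-- Hilbert's inequality for indicator vectors. -/
lemma abs_sum_hilbertMatrix_le {n : ℕ} (S T : Finset (Fin n)) :
    |∑ i ∈ S, ∑ j ∈ T, hilbertMatrix n i j| ≤ π * n := by
  have hrep : 2 * π * ∑ i ∈ S, ∑ j ∈ T, hilbertMatrix n i j
      = ∫ t in (0 : ℝ)..2 * π,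
        (π - t) * ∑ i ∈ S, ∑ j ∈ T, sin ((((i : ℤ) - (j : ℤ) : ℤ) : ℝ) * t) := by
    simp_rw [Finset.mul_sum]
    rw [intervalIntegral.integral_finsetSum
      (fun i _ => Continuous.intervalIntegrable (by fun_prop) _ _)]
    refine Finset.sum_congr rfl fun i _ => ?_
    rw [intervalIntegral.integral_finsetSum
      (fun j _ => Continuous.intervalIntegrable (by fun_prop) _ _)]
    exact Finset.sum_congr rfl fun j _ => (integral_sub_mul_sin _).symm
  have hbound : |2 * π * ∑ i ∈ S, ∑ j ∈ T, hilbertMatrix n i j|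
      ≤ ∫ t in (0 : ℝ)..2 * π,
        π / 2 * ((∑ i ∈ S, ∑ j ∈ S, cos ((((i : ℤ) - (j : ℤ) : ℤ) : ℝ) * t))
        + ∑ i ∈ T, ∑ j ∈ T, cos ((((i : ℤ) - (j : ℤ) : ℤ) : ℝ) * t)) := by
    rw [hrep]
    refine (intervalIntegral.abs_integral_le_integral_abs two_pi_pos.le).trans ?_
    refine intervalIntegral.integral_mono_on two_pi_pos.le
      (Continuous.intervalIntegrable (by fun_prop) _ _)
      (Continuous.intervalIntegrable (by fun_prop) _ _) ?_
    intro t ht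
    rw [abs_mul]
    have hpi : |π - t| ≤ π := abs_le.2 ⟨by linarith [ht.2], by linarith [ht.1]⟩
    calc _ ≤ π * _ := mul_le_mul hpi (abs_sum_sin_sub_le S T t) (abs_nonneg _) pi_pos.le
      _ = _ := by ring
  rw [intervalIntegral.integral_const_mul, intervalIntegral.integral_add
    (Continuous.intervalIntegrable (by fun_prop) _ _)
    (Continuous.intervalIntegrable (by fun_prop) _ _),
    integral_sum_cos_sub, integral_sum_cos_sub, abs_mul, abs_of_pos two_pi_pos] at hbound
  have hcard : ∀ U : Finset (Fin n), (U.card : ℝ) ≤ n := by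
    intro U
    exact_mod_cast card_finset_fin_le U
  have hfinal : 2 * π * |∑ i ∈ S, ∑ j ∈ T, hilbertMatrix n i j| ≤ 2 * π * (π * n) := by
    refine hbound.trans ?_
    nlinarith [mul_le_mul_of_nonneg_left (add_le_add (hcard S) (hcard T)) (sq_nonneg π)]
  exact le_of_mul_le_mul_left hfinal two_pi_pos

lemma le_cutNorm {n : ℕ} (A : Matrix (Fin n) (Fin n) ℝ) (S T : Finset (Fin n)) :
    1 / (n : ℝ) ^ 2 * |∑ i ∈ S, ∑ j ∈ T, A i j| ≤ cutNorm A := by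
  refine mul_le_mul_of_nonneg_left (le_csSup ?_ ⟨S, T, rfl⟩) (by positivity)
  refine ((Set.finite_range fun p : Finset (Fin n) × Finset (Fin n) =>
    |∑ i ∈ p.1, ∑ j ∈ p.2, A i j|).subset ?_).bddAbove
  rintro r ⟨S, T, rfl⟩
  exact ⟨(S, T), rfl⟩

lemma cutNorm_le {n : ℕ} {A : Matrix (Fin n) (Fin n) ℝ} {C : ℝ}
    (h : ∀ S T : Finset (Fin n), |∑ i ∈ S, ∑ j ∈ T, A i j| ≤ C) :
    cutNorm A ≤ 1 / (n : ℝ) ^ 2 * C := by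
  refine mul_le_mul_of_nonneg_left (csSup_le ⟨_, ∅, ∅, rfl⟩ ?_) (by positivity)
  rintro r ⟨S, T, rfl⟩
  exact h S T

lemma cutNorm_nonneg {n : ℕ} (A : Matrix (Fin n) (Fin n) ℝ) : 0 ≤ cutNorm A := by
  simpa using le_cutNorm A ∅ ∅

lemma cutNorm_tri_le {n : ℕ} (A : Matrix (Fin n) (Fin n) ℝ) :
    cutNorm (tri A) ≤ (n : ℝ) ^ 2 * cutNorm A := by
  rcases Nat.eq_zero_or_pos n with rfl | hn
  · simp [cutNorm]
  have hn' : (0 : ℝ) < (n : ℝ) ^ 2 := by positivity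
  have hentry : ∀ i j, |tri A i j| ≤ (n : ℝ) ^ 2 * cutNorm A := by
    intro i j
    have h := le_cutNorm A {i} {j}
    simp only [Finset.sum_singleton] at h
    rw [one_div, inv_mul_le_iff₀ hn'] at h
    unfold tri
    split_ifs
    · exact h
    · simpa using (abs_nonneg _).trans h
  calc cutNorm (tri A) ≤ 1 / (n : ℝ) ^ 2 * ((n : ℝ) ^ 2 * ((n : ℝ) ^ 2 * cutNorm A)) := by
        refine cutNorm_le fun S T => ?_
        calc |∑ i ∈ S, ∑ j ∈ T, tri A i j| ≤ ∑ i ∈ S, ∑ j ∈ T, |tri A i j| :=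
              (Finset.abs_sum_le_sum_abs _ _).trans
                (Finset.sum_le_sum fun i _ => Finset.abs_sum_le_sum_abs _ _)
          _ ≤ ∑ i : Fin n, ∑ j : Fin n, |tri A i j| :=
              (Finset.sum_le_univ_sum_of_nonneg fun i =>
                Finset.sum_nonneg fun j _ => abs_nonneg _).trans
                (Finset.sum_le_sum fun i _ =>
                  Finset.sum_le_univ_sum_of_nonneg fun j => abs_nonneg _)
          _ ≤ ∑ _i : Fin n, ∑ _j : Fin n, (n : ℝ) ^ 2 * cutNorm A :=
              Finset.sum_le_sum fun i _ => Finset.sum_le_sum fun j _ => hentry i j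
          _ = _ := by
              simp
              ring
    _ = _ := by field_simp

lemma bddAbove_cutNorm_tri_div (n : ℕ) :
    BddAbove {r : ℝ | ∃ A : Matrix (Fin n) (Fin n) ℝ,
      cutNorm A ≠ 0 ∧ r = cutNorm (tri A) / cutNorm A} := by
  refine ⟨(n : ℝ) ^ 2, ?_⟩
  rintro r ⟨A, hA, rfl⟩
  exact (div_le_iff₀ ((cutNorm_nonneg A).lt_of_ne' hA)).2 (cutNorm_tri_le A)

lemma sum_tri_hilbertMatrix_row {n : ℕ} (i : Fin n) :
    ∑ j : Fin n, tri (hilbertMatrix n) i j = ∑ k ∈ Finset.range i, 1 / ((k : ℝ) + 1) := by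
  have hrow : ∀ j : Fin n, tri (hilbertMatrix n) i j
      = (fun j : ℕ => if j < (i : ℕ) then ((i : ℝ) - j)⁻¹ else 0) j := by
    intro j
    rcases lt_trichotomy j i with h | h | h
    · simp [tri, hilbertMatrix, h, h.le]
    · simp [tri, hilbertMatrix, h]
    · simp [tri, h.not_ge, h.not_gt]
  rw [Finset.sum_congr rfl fun j _ => hrow j,
    Fin.sum_univ_eq_sum_range (fun j : ℕ => if j < (i : ℕ) then ((i : ℝ) - j)⁻¹ else 0), ← Finset.sum_filter,
    ← Finset.sum_range_reflect]
  have hfilter : (Finset.range n).filter (· < (i : ℕ)) = Finset.range i := by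
    ext j
    simp only [Finset.mem_filter, Finset.mem_range]
    have := i.2
    omega
  rw [hfilter]
  refine Finset.sum_congr rfl fun j hj => ?_
  rw [Finset.mem_range] at hj
  rw [Nat.sub_sub, Nat.cast_sub (by omega), one_div]
  push_cast
  congr 1
  ring

lemma le_sum_tri_hilbertMatrix (n : ℕ) :
    (n : ℝ) / 2 * ∑ k ∈ Finset.range (n / 2), 1 / ((k : ℝ) + 1)
      ≤ ∑ i : Fin n, ∑ j : Fin n, tri (hilbertMatrix n) i j := by
  simp_rw [sum_tri_hilbertMatrix_row]
  rw [Fin.sum_univ_eq_sum_range (fun i => ∑ k ∈ Finset.range i, 1 / ((k : ℝ) + 1))]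
  have hnonneg : ∀ m : ℕ, 0 ≤ ∑ k ∈ Finset.range m, 1 / ((k : ℝ) + 1) :=
    fun m => Finset.sum_nonneg fun k _ => by positivity
  have hhalf : (n : ℝ) / 2 ≤ ((n - n / 2 : ℕ) : ℝ) := by
    rw [div_le_iff₀ two_pos]
    exact_mod_cast (by omega : n ≤ (n - n / 2) * 2)
  calc _ ≤ ((n - n / 2 : ℕ) : ℝ) * ∑ k ∈ Finset.range (n / 2), 1 / ((k : ℝ) + 1) :=
        mul_le_mul_of_nonneg_right hhalf (hnonneg _)
    _ = ∑ _i ∈ Finset.Ico (n / 2) n, ∑ k ∈ Finset.range (n / 2), 1 / ((k : ℝ) + 1) := by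
        rw [Finset.sum_const, Nat.card_Ico, nsmul_eq_mul]
    _ ≤ ∑ i ∈ Finset.Ico (n / 2) n, ∑ k ∈ Finset.range i, 1 / ((k : ℝ) + 1) := by
        refine Finset.sum_le_sum fun i hi => Finset.sum_le_sum_of_subset_of_nonneg
          (Finset.range_subset_range.2 (Finset.mem_Ico.1 hi).1) fun k _ _ => by positivity
    _ ≤ _ := by
        refine Finset.sum_le_sum_of_subset_of_nonneg (fun i hi => ?_) fun i _ _ => hnonneg i
        exact Finset.mem_range.2 (Finset.mem_Ico.1 hi).2

lemma cutNorm_hilbertMatrix_pos {n : ℕ} (hn : 2 ≤ n) : 0 < cutNorm (hilbertMatrix n) := by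
  refine lt_of_lt_of_le ?_ (le_cutNorm _ {⟨1, by omega⟩} {⟨0, by omega⟩})
  simp [hilbertMatrix]
  exact pow_pos (Nat.cast_pos.2 (by omega)) 2

lemma harmonic_div_le_cutNorm_ratio {n : ℕ} (hn : 2 ≤ n) :
    (∑ k ∈ Finset.range (n / 2), 1 / ((k : ℝ) + 1)) / (2 * Real.pi)
      ≤ cutNorm (tri (hilbertMatrix n)) / cutNorm (hilbertMatrix n) := by
  have hn' : (0 : ℝ) < n := by exact_mod_cast (by omega : 0 < n)
  have hpi := Real.pi_pos
  rw [div_le_div_iff₀ (by positivity) (cutNorm_hilbertMatrix_pos hn)]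
  have hsum : 0 ≤ ∑ k ∈ Finset.range (n / 2), 1 / ((k : ℝ) + 1) :=
    Finset.sum_nonneg fun k _ => by positivity
  have hupper := cutNorm_le (abs_sum_hilbertMatrix_le (n := n))
  have hlower : 1 / (n : ℝ) ^ 2 * (n / 2 * ∑ k ∈ Finset.range (n / 2), 1 / ((k : ℝ) + 1))
      ≤ cutNorm (tri (hilbertMatrix n)) :=
    (mul_le_mul_of_nonneg_left ((le_sum_tri_hilbertMatrix n).trans (le_abs_self _))
      (by positivity)).trans (le_cutNorm _ Finset.univ Finset.univ)
  calc _ ≤ (∑ k ∈ Finset.range (n / 2), 1 / ((k : ℝ) + 1))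
          * (1 / (n : ℝ) ^ 2 * (Real.pi * n)) := mul_le_mul_of_nonneg_left hupper hsum
    _ = (1 / (n : ℝ) ^ 2 * (n / 2 * ∑ k ∈ Finset.range (n / 2), 1 / ((k : ℝ) + 1)))
          * (2 * Real.pi) := by ring
    _ ≤ _ := mul_le_mul_of_nonneg_right hlower (by positivity)

/-- `sup_{A ∈ Mₙ(ℝ), ‖A‖_□ ≠ 0} ‖𝒯ₙ(A)‖_□ / ‖A‖_□ → ∞` as `n → ∞`. -/
theorem triCut_cutNorm_unbounded :
    Tendsto
      (fun n : ℕ => sSup {r : ℝ | ∃ A : Matrix (Fin n) (Fin n) ℝ,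
        cutNorm A ≠ 0 ∧ r = cutNorm (tri A) / cutNorm A})
      atTop atTop := by
  have hharm : Tendsto (fun n : ℕ =>
      (∑ k ∈ Finset.range (n / 2), 1 / ((k : ℝ) + 1)) / (2 * Real.pi)) atTop atTop :=
    (Real.tendsto_sum_range_one_div_nat_succ_atTop.comp
      (Nat.tendsto_div_const_atTop two_ne_zero)).atTop_div_const Real.two_pi_pos
  refine tendsto_atTop_mono' _ ?_ hharm
  filter_upwards [eventually_ge_atTop 2] with n hn
  exact (harmonic_div_le_cutNorm_ratio hn).trans (le_csSup (bddAbove_cutNorm_tri_div n)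
    ⟨hilbertMatrix n, (cutNorm_hilbertMatrix_pos hn).ne', rfl⟩)
end

section
/- For every c > 0 there exists a bounded symmetric measurable function w : [0,1]² → ℝ such that ‖w·χ‖_□ > c·‖w‖_□. In particular, the triangular cut operator M_χ : w ↦ w·χ is unbounded on the space of bounded symmetric measurable functions on [0,1]² equipped with the cut norm (and hence on the space of symmetric L^p functions equipped with the cut norm, for every 1 ≤ p ≤ ∞). -/
open MeasureTheory Filter

/-- Cut norm of a function on `[0,1]²`:
`sup_{S,T ⊆ [0,1] measurable} |∫_{S×T} w(x,y) dx dy|`. -/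
noncomputable def cutNormFn (w : ℝ → ℝ → ℝ) : ℝ :=
  sSup {r : ℝ | ∃ S T : Set ℝ, MeasurableSet S ∧ MeasurableSet T ∧
    S ⊆ Set.Icc 0 1 ∧ T ⊆ Set.Icc 0 1 ∧ r = |∫ p in S ×ˢ T, w p.1 p.2|}
/-- The triangular indicator `χ(x,y) = 1` if `x ≤ y` and `0` if `x > y`. -/
noncomputable def chi (x y : ℝ) : ℝ := if x ≤ y then 1 else 0

/-- The `2 × 2` block `!![1, a; -a, 1]`, indexed by parities. -/
def rotBlock (a : ℝ) (i j : ℕ) : ℝ :=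
  if i % 2 = j % 2 then 1 else if i % 2 = 0 then a else -a

/-- The `k`-fold Kronecker power of `rotBlock a`, indexed by binary digits. -/
def rotPower (a : ℝ) : ℕ → ℕ → ℕ → ℝ
  | 0 => fun _ _ => 1
  | k + 1 => fun i j => rotPower a k (i / 2) (j / 2) * rotBlock a i j

/-- Twice the antisymmetric part of `rotPower`, tensored with the antisymmetric block
`!![0, 1; -1, 0]`; this is a symmetric matrix. -/
def symRot (a : ℝ) (k i j : ℕ) : ℝ :=
  (rotPower a k (i / 2) (j / 2) - rotPower a k (j / 2) (i / 2)) *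
    (if i % 2 = j % 2 then 0 else if i % 2 = 0 then 1 else -1)

theorem symRot_comm (a : ℝ) (k i j : ℕ) : symRot a k i j = symRot a k j i := by
  unfold symRot
  rcases Nat.mod_two_eq_zero_or_one i with hi | hi <;>
  rcases Nat.mod_two_eq_zero_or_one j with hj | hj <;> simp [hi, hj]

theorem abs_rotPower_le {a : ℝ} (ha : |a| ≤ 1) (k i j : ℕ) : |rotPower a k i j| ≤ 1 := by
  induction k generalizing i j with
  | zero => simp [rotPower]
  | succ k ih =>
    have hb : |rotBlock a i j| ≤ 1 := by
      unfold rotBlock; split_ifs <;> simp [ha]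
    rw [rotPower, abs_mul]
    exact mul_le_one₀ (ih _ _) (abs_nonneg _) hb

theorem rotPower_self (a : ℝ) (k i : ℕ) : rotPower a k i i = 1 := by
  induction k generalizing i with
  | zero => rfl
  | succ k ih => simp [rotPower, rotBlock, ih]

theorem abs_symRot_le {a : ℝ} (ha : |a| ≤ 1) (k i j : ℕ) : |symRot a k i j| ≤ 2 := by
  have h1 := abs_le.1 (abs_rotPower_le ha k (i / 2) (j / 2))
  have h2 := abs_le.1 (abs_rotPower_le ha k (j / 2) (i / 2))
  unfold symRot
  rw [abs_le]
  split_ifs <;> constructor <;> linarith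

theorem sum_range_two_mul (n : ℕ) (f : ℕ → ℝ) :
    ∑ i ∈ Finset.range (2 * n), f i = ∑ i ∈ Finset.range n, (f (2 * i) + f (2 * i + 1)) := by
  induction n with
  | zero => simp
  | succ n ih =>
    rw [Nat.mul_succ, Finset.sum_range_succ, Finset.sum_range_succ, ih, Finset.sum_range_succ]
    ring

theorem sum_sum_range_two_mul (n : ℕ) (f : ℕ → ℕ → ℝ) :
    ∑ i ∈ Finset.range (2 * n), ∑ j ∈ Finset.range (2 * n), f i j =
      ∑ i ∈ Finset.range n, ∑ j ∈ Finset.range n,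
        (f (2 * i) (2 * j) + f (2 * i) (2 * j + 1) +
          (f (2 * i + 1) (2 * j) + f (2 * i + 1) (2 * j + 1))) := by
  rw [sum_range_two_mul]
  refine Finset.sum_congr rfl fun i _ => ?_
  rw [sum_range_two_mul, sum_range_two_mul, ← Finset.sum_add_distrib]

theorem add_sq_le_mul_add_of_sq_le {p q K X Y X' Y' : ℝ} (hK : 0 ≤ K) (hX : 0 ≤ X) (hY : 0 ≤ Y)
    (hX' : 0 ≤ X') (hY' : 0 ≤ Y') (hp : p ^ 2 ≤ K * (X * Y)) (hq : q ^ 2 ≤ K * (X' * Y')) :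
    (p + q) ^ 2 ≤ K * ((X + X') * (Y + Y')) := by
  have h1 : (p * q) ^ 2 ≤ (K * (X * Y)) * (K * (X' * Y')) := by
    rw [mul_pow]; gcongr
  have h2 : 2 * (p * q) ≤ K * (X * Y' + X' * Y) := by
    apply le_of_abs_le
    apply abs_le_of_sq_le_sq _ (by positivity)
    nlinarith [sq_nonneg (K * (X * Y' - X' * Y))]
  nlinarith

theorem rotPower_form_sq_le (a : ℝ) (k : ℕ) (s t : ℕ → ℝ) :
    (∑ i ∈ Finset.range (2 ^ k), ∑ j ∈ Finset.range (2 ^ k), rotPower a k i j * s i * t j) ^ 2 ≤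
      (1 + a ^ 2) ^ k *
        ((∑ i ∈ Finset.range (2 ^ k), s i ^ 2) * ∑ j ∈ Finset.range (2 ^ k), t j ^ 2) := by
  induction k generalizing s t with
  | zero => simp [rotPower, mul_pow]
  | succ k ih =>
    have h1 := ih (fun i => s (2 * i)) (fun j => t (2 * j) + a * t (2 * j + 1))
    have h2 := ih (fun i => s (2 * i + 1)) (fun j => t (2 * j + 1) - a * t (2 * j))
    have h := add_sq_le_mul_add_of_sq_le (by positivity) (by positivity) (by positivity)
      (by positivity) (by positivity) h1 h2
    rw [pow_succ' 2, sum_sum_range_two_mul, sum_range_two_mul, sum_range_two_mul]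
    convert h using 1
    · rw [← Finset.sum_add_distrib]
      congr 1
      refine Finset.sum_congr rfl fun i _ => ?_
      rw [← Finset.sum_add_distrib]
      refine Finset.sum_congr rfl fun j _ => ?_
      have e1 : (2 * i + 1) / 2 = i := by omega
      have e2 : (2 * j + 1) / 2 = j := by omega
      simp [rotPower, rotBlock, e1, e2, Nat.add_mod]
      ring
    · rw [← Finset.sum_add_distrib, ← Finset.sum_add_distrib, pow_succ, mul_assoc]
      congr 1
      rw [mul_left_comm, Finset.mul_sum]
      congr 1
      refine Finset.sum_congr rfl fun j _ => ?_
      ring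

theorem symRot_form_sq_le (a : ℝ) (k : ℕ) (s t : ℕ → ℝ) :
    (∑ i ∈ Finset.range (2 ^ (k + 1)), ∑ j ∈ Finset.range (2 ^ (k + 1)),
        symRot a k i j * s i * t j) ^ 2 ≤
      (4 * (1 + a ^ 2) ^ k) *
        ((∑ i ∈ Finset.range (2 ^ (k + 1)), s i ^ 2) *
          ∑ j ∈ Finset.range (2 ^ (k + 1)), t j ^ 2) := by
  have key : ∀ x y : ℕ → ℝ, (∑ i ∈ Finset.range (2 ^ k), ∑ j ∈ Finset.range (2 ^ k),
      (rotPower a k i j - rotPower a k j i) * x i * y j) ^ 2 ≤ (4 * (1 + a ^ 2) ^ k) *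
        ((∑ i ∈ Finset.range (2 ^ k), x i ^ 2) * ∑ j ∈ Finset.range (2 ^ k), y j ^ 2) := by
    intro x y
    have h1 := rotPower_form_sq_le a k x y
    have h2 := rotPower_form_sq_le a k y x
    rw [Finset.sum_comm] at h2
    have e : ∑ i ∈ Finset.range (2 ^ k), ∑ j ∈ Finset.range (2 ^ k),
        (rotPower a k i j - rotPower a k j i) * x i * y j =
        (∑ i ∈ Finset.range (2 ^ k), ∑ j ∈ Finset.range (2 ^ k), rotPower a k i j * x i * y j) -
        ∑ i ∈ Finset.range (2 ^ k), ∑ j ∈ Finset.range (2 ^ k), rotPower a k j i * y j * x i := by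
      rw [← Finset.sum_sub_distrib]
      refine Finset.sum_congr rfl fun i _ => ?_
      rw [← Finset.sum_sub_distrib]
      refine Finset.sum_congr rfl fun j _ => ?_
      ring
    rw [e]
    generalize (∑ i ∈ Finset.range (2 ^ k), ∑ j ∈ Finset.range (2 ^ k),
      rotPower a k i j * x i * y j) = p at *
    generalize (∑ i ∈ Finset.range (2 ^ k), ∑ j ∈ Finset.range (2 ^ k),
      rotPower a k j i * y j * x i) = q at *
    nlinarith [sq_nonneg (p + q)]
  have h := add_sq_le_mul_add_of_sq_le (by positivity) (by positivity) (by positivity)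
      (by positivity) (by positivity) (key (fun i => s (2 * i)) (fun j => t (2 * j + 1)))
      (key (fun i => s (2 * i + 1)) (fun j => - t (2 * j)))
  rw [pow_succ' 2, sum_sum_range_two_mul, sum_range_two_mul, sum_range_two_mul]
  convert h using 1
  · rw [← Finset.sum_add_distrib]
    congr 1
    refine Finset.sum_congr rfl fun i _ => ?_
    rw [← Finset.sum_add_distrib]
    refine Finset.sum_congr rfl fun j _ => ?_
    have e1 : (2 * i + 1) / 2 = i := by omega
    have e2 : (2 * j + 1) / 2 = j := by omega
    simp [symRot, e1, e2, Nat.add_mod]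
    ring
  · rw [← Finset.sum_add_distrib, ← Finset.sum_add_distrib]
    congr 2
    refine Finset.sum_congr rfl fun j _ => ?_
    ring

theorem sum_upper_rotPower_sub (a : ℝ) (k : ℕ) :
    ∑ i ∈ Finset.range (2 ^ k), ∑ j ∈ Finset.range (2 ^ k),
      (if i < j then rotPower a k i j - rotPower a k j i else 0) = k * a * 2 ^ k := by
  induction k with
  | zero => simp
  | succ k ih =>
    have e : ∀ i j : ℕ,
        (if 2 * i < 2 * j then
          rotPower a (k + 1) (2 * i) (2 * j) - rotPower a (k + 1) (2 * j) (2 * i) else 0) +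
        (if 2 * i < 2 * j + 1 then
          rotPower a (k + 1) (2 * i) (2 * j + 1) - rotPower a (k + 1) (2 * j + 1) (2 * i) else 0) +
        ((if 2 * i + 1 < 2 * j then
          rotPower a (k + 1) (2 * i + 1) (2 * j) - rotPower a (k + 1) (2 * j) (2 * i + 1) else 0) +
        (if 2 * i + 1 < 2 * j + 1 then
          rotPower a (k + 1) (2 * i + 1) (2 * j + 1) -
            rotPower a (k + 1) (2 * j + 1) (2 * i + 1) else 0)) =
        2 * (if i < j then rotPower a k i j - rotPower a k j i else 0) +
          (if i = j then 2 * a else 0) := by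
      intro i j
      have e1 : (2 * i + 1) / 2 = i := by omega
      have e2 : (2 * j + 1) / 2 = j := by omega
      rcases lt_trichotomy i j with h | h | h
      · have h1 : 2 * i < 2 * j + 1 := by omega
        have h2 : 2 * i + 1 < 2 * j := by omega
        simp [rotPower, rotBlock, e1, e2, Nat.add_mod, h, h1, h2, h.ne]
        ring
      · subst h
        simp [rotPower, rotBlock, e1, Nat.add_mod, rotPower_self]
        ring
      · have h1 : ¬ 2 * i < 2 * j + 1 := by omega
        have h2 : ¬ 2 * i + 1 < 2 * j := by omega
        simp [h1, h2, h.not_gt, h.ne']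
    rw [pow_succ' 2, sum_sum_range_two_mul]
    simp_rw [e, Finset.sum_add_distrib, ← Finset.mul_sum]
    rw [ih]
    have : ∀ i ∈ Finset.range (2 ^ k),
        (∑ j ∈ Finset.range (2 ^ k), if i = j then 2 * a else 0) = 2 * a := by
      intro i hi
      rw [Finset.sum_ite_eq, if_pos hi]
    rw [Finset.sum_congr rfl this]
    simp
    ring

theorem sum_upper_symRot (a : ℝ) (k : ℕ) :
    ∑ i ∈ Finset.range (2 ^ (k + 1)), ∑ j ∈ Finset.range (2 ^ (k + 1)),
      (if i ≤ j then symRot a k i j else 0) * (if i % 2 = 0 then 1 else 0) *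
        (if j % 2 = 1 then 1 else 0) = k * a * 2 ^ k := by
  rw [← sum_upper_rotPower_sub, pow_succ' 2, sum_sum_range_two_mul]
  refine Finset.sum_congr rfl fun i _ => Finset.sum_congr rfl fun j _ => ?_
  have e2 : (2 * j + 1) / 2 = j := by omega
  rcases lt_trichotomy i j with h | h | h
  · have h1 : 2 * i ≤ 2 * j + 1 := by omega
    simp [symRot, e2, Nat.add_mod, h, h1]
  · subst h
    simp [symRot, e2, Nat.add_mod]
  · have h1 : ¬ 2 * i ≤ 2 * j + 1 := by omega
    simp [Nat.add_mod, h.not_gt, h1]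

/-- The `i`-th cell of the partition of `ℝ` into level sets of `x ↦ ⌊n x⌋₊`. -/
def floorCell (n i : ℕ) : Set ℝ := {x | ⌊(n : ℝ) * x⌋₊ = i}

theorem measurable_floor_mul (n : ℕ) : Measurable fun x : ℝ => ⌊(n : ℝ) * x⌋₊ :=
  Nat.measurable_floor.comp (measurable_id.const_mul _)

theorem measurableSet_floorCell (n i : ℕ) : MeasurableSet (floorCell n i) :=
  measurable_floor_mul n (measurableSet_singleton i)

theorem volume_Ico_inter_floorCell {n : ℕ} (hn : 0 < n) {i : ℕ} (hi : i < n) :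
    volume.real (Set.Ico (0 : ℝ) 1 ∩ floorCell n i) = (n : ℝ)⁻¹ := by
  have hn' : (0 : ℝ) < n := by exact_mod_cast hn
  have : Set.Ico (0 : ℝ) 1 ∩ floorCell n i = Set.Ico ((i : ℝ) / n) ((i + 1) / n) := by
    ext x
    simp only [floorCell, Set.mem_inter_iff, Set.mem_Ico, Set.mem_ofPred_eq]
    rw [div_le_iff₀ hn', lt_div_iff₀ hn', mul_comm x]
    constructor
    · rintro ⟨⟨h0, _⟩, h⟩
      exact (Nat.floor_eq_iff (by positivity)).1 h
    · rintro ⟨h1, h2⟩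
      have h0 : 0 ≤ (n : ℝ) * x := le_trans (by positivity) h1
      refine ⟨⟨nonneg_of_mul_nonneg_right h0 hn', ?_⟩, (Nat.floor_eq_iff h0).2 ⟨h1, h2⟩⟩
      have : (i : ℝ) + 1 ≤ n := by exact_mod_cast hi
      nlinarith
  rw [this, Real.volume_real_Ico_of_le (by gcongr; linarith)]
  field_simp
  ring

theorem setIntegral_step {n : ℕ} (hn : 0 < n) (M : ℕ → ℕ → ℝ) {S T : Set ℝ}
    (hS : MeasurableSet S) (hT : MeasurableSet T)
    (hS1 : S ⊆ Set.Ico 0 1) (hT1 : T ⊆ Set.Ico 0 1) :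
    ∫ p in S ×ˢ T, M ⌊(n : ℝ) * p.1⌋₊ ⌊(n : ℝ) * p.2⌋₊ =
      ∑ i ∈ Finset.range n, ∑ j ∈ Finset.range n,
        M i j * volume.real (S ∩ floorCell n i) * volume.real (T ∩ floorCell n j) := by
  have hn' : (0 : ℝ) < n := by exact_mod_cast hn
  have hlt : ∀ x ∈ Set.Ico (0 : ℝ) 1, ⌊(n : ℝ) * x⌋₊ < n := by
    intro x hx
    rw [Nat.floor_lt (mul_nonneg hn'.le hx.1)]
    nlinarith [hx.2]
  have hfin : ∀ (A : Set ℝ), A ⊆ Set.Ico 0 1 → volume A ≠ ⊤ := fun A hA =>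
    measure_ne_top_of_subset hA (by simp)
  have hU : S ×ˢ T = ⋃ q ∈ Finset.range n ×ˢ Finset.range n,
      (S ∩ floorCell n q.1) ×ˢ (T ∩ floorCell n q.2) := by
    ext ⟨x, y⟩
    simp only [Set.mem_prod, Set.mem_iUnion, Finset.mem_product, Finset.mem_range,
      Set.mem_inter_iff, floorCell, Set.mem_ofPred_eq, exists_prop, Prod.exists]
    constructor
    · rintro ⟨hx, hy⟩
      exact ⟨_, _, ⟨hlt x (hS1 hx), hlt y (hT1 hy)⟩, ⟨hx, rfl⟩, hy, rfl⟩
    · rintro ⟨i, j, -, ⟨hx, -⟩, hy, -⟩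
      exact ⟨hx, hy⟩
  have hcell : ∀ q : ℕ × ℕ, MeasurableSet ((S ∩ floorCell n q.1) ×ˢ (T ∩ floorCell n q.2)) :=
    fun q => (hS.inter (measurableSet_floorCell n _)).prod (hT.inter (measurableSet_floorCell n _))
  have heq : ∀ q : ℕ × ℕ, Set.EqOn
      (fun p : ℝ × ℝ => M ⌊(n : ℝ) * p.1⌋₊ ⌊(n : ℝ) * p.2⌋₊) (fun _ => M q.1 q.2)
      ((S ∩ floorCell n q.1) ×ˢ (T ∩ floorCell n q.2)) := by
    rintro ⟨i, j⟩ ⟨x, y⟩ ⟨⟨-, hx⟩, -, hy⟩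
    simp only [floorCell, Set.mem_ofPred_eq] at hx hy
    simp only [hx, hy]
  rw [hU, integral_biUnion_finset _ (fun q _ => hcell q), Finset.sum_product]
  · refine Finset.sum_congr rfl fun i _ => Finset.sum_congr rfl fun j _ => ?_
    rw [setIntegral_congr_fun (hcell (i, j)) (heq (i, j)), setIntegral_const,
      Measure.volume_eq_prod, measureReal_prod_prod, smul_eq_mul]
    ring
  · rintro ⟨i, j⟩ - ⟨i', j'⟩ - hne
    rw [Function.onFun, Set.disjoint_left]
    rintro ⟨x, y⟩ ⟨⟨-, hx⟩, -, hy⟩ ⟨⟨-, hx'⟩, -, hy'⟩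
    exact hne (Prod.ext (hx.symm.trans hx') (hy.symm.trans hy'))
  · intro q _
    refine (integrableOn_congr_fun (heq q) (hcell q)).2 (integrableOn_const ?_)
    rw [Measure.volume_eq_prod, Measure.prod_prod]
    exact ENNReal.mul_ne_top (hfin _ (Set.inter_subset_left.trans hS1))
      (hfin _ (Set.inter_subset_left.trans hT1))

theorem setIntegral_step_Icc {n : ℕ} (hn : 0 < n) (M : ℕ → ℕ → ℝ) {S T : Set ℝ}
    (hS : MeasurableSet S) (hT : MeasurableSet T)
    (hS1 : S ⊆ Set.Icc 0 1) (hT1 : T ⊆ Set.Icc 0 1) :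
    ∫ p in S ×ˢ T, M ⌊(n : ℝ) * p.1⌋₊ ⌊(n : ℝ) * p.2⌋₊ =
      ∑ i ∈ Finset.range n, ∑ j ∈ Finset.range n,
        M i j * volume.real (S \ {1} ∩ floorCell n i) *
          volume.real (T \ {1} ∩ floorCell n j) := by
  have hsub : ∀ {A : Set ℝ}, A ⊆ Set.Icc 0 1 → A \ {1} ⊆ Set.Ico 0 1 := fun hA x hx =>
    ⟨(hA hx.1).1, lt_of_le_of_ne (hA hx.1).2 hx.2⟩
  rw [← setIntegral_step hn M (hS.diff (measurableSet_singleton 1))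
    (hT.diff (measurableSet_singleton 1)) (hsub hS1) (hsub hT1)]
  refine setIntegral_congr_set ?_
  rw [Measure.volume_eq_prod]
  exact Measure.set_prod_ae_eq (sdiff_null_ae_eq_self (by simp)).symm
    (sdiff_null_ae_eq_self (by simp)).symm

theorem sum_sq_volume_floorCell_le {n : ℕ} (hn : 0 < n) {S : Set ℝ} (hS : S ⊆ Set.Icc 0 1) :
    ∑ i ∈ Finset.range n, volume.real (S \ {1} ∩ floorCell n i) ^ 2 ≤ (n : ℝ)⁻¹ := by
  have hn' : (0 : ℝ) < n := by exact_mod_cast hn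
  calc ∑ i ∈ Finset.range n, volume.real (S \ {1} ∩ floorCell n i) ^ 2
      ≤ ∑ i ∈ Finset.range n, ((n : ℝ)⁻¹) ^ 2 := by
        refine Finset.sum_le_sum fun i hi => ?_
        gcongr
        rw [← volume_Ico_inter_floorCell hn (Finset.mem_range.1 hi)]
        refine measureReal_mono (Set.inter_subset_inter_left _ fun x hx =>
          ⟨(hS hx.1).1, lt_of_le_of_ne (hS hx.1).2 hx.2⟩) ?_
        exact measure_ne_top_of_subset Set.inter_subset_left (by simp)
    _ = (n : ℝ)⁻¹ := by
        simp
        field_simp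

theorem volume_Ico_floor_inter_floorCell {n : ℕ} (hn : 0 < n) (P : ℕ → Prop) [DecidablePred P]
    {i : ℕ} (hi : i < n) :
    volume.real ({x ∈ Set.Ico (0 : ℝ) 1 | P ⌊(n : ℝ) * x⌋₊} ∩ floorCell n i) =
      (n : ℝ)⁻¹ * (if P i then 1 else 0) := by
  by_cases h : P i
  · rw [if_pos h, mul_one, ← volume_Ico_inter_floorCell hn hi]
    congr 1
    ext x
    simp only [floorCell, Set.mem_inter_iff, Set.mem_ofPred_eq]
    constructor
    · rintro ⟨⟨h1, -⟩, h2⟩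
      exact ⟨h1, h2⟩
    · rintro ⟨h1, h2⟩
      exact ⟨⟨h1, h2 ▸ h⟩, h2⟩
  · have : {x ∈ Set.Ico (0 : ℝ) 1 | P ⌊(n : ℝ) * x⌋₊} ∩ floorCell n i = ∅ := by
      ext x
      simp only [floorCell, Set.mem_inter_iff, Set.mem_ofPred_eq, Set.mem_empty_iff_false, iff_false]
      rintro ⟨⟨-, h1⟩, h2⟩
      exact h (h2 ▸ h1)
    rw [this, if_neg h, mul_zero, measureReal_empty]

theorem abs_setIntegral_le_cutNormFn {w : ℝ → ℝ → ℝ} {C : ℝ} (hw : ∀ x y, |w x y| ≤ C)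
    {S T : Set ℝ} (hS : MeasurableSet S) (hT : MeasurableSet T)
    (hS1 : S ⊆ Set.Icc 0 1) (hT1 : T ⊆ Set.Icc 0 1) :
    |∫ p in S ×ˢ T, w p.1 p.2| ≤ cutNormFn w := by
  refine le_csSup ⟨C, ?_⟩ ⟨S, T, hS, hT, hS1, hT1, rfl⟩
  rintro r ⟨A, B, -, -, hA, hB, rfl⟩
  have hC : 0 ≤ C := (abs_nonneg _).trans (hw 0 0)
  have hsub : A ×ˢ B ⊆ Set.Icc (0 : ℝ) 1 ×ˢ Set.Icc (0 : ℝ) 1 := Set.prod_mono hA hB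
  have hI : volume (Set.Icc (0 : ℝ) 1 ×ˢ Set.Icc (0 : ℝ) 1) = 1 := by
    rw [Measure.volume_eq_prod, Measure.prod_prod]; simp
  have hle : volume (A ×ˢ B) ≤ 1 := hI ▸ measure_mono hsub
  have h := norm_setIntegral_le_of_norm_le_const (f := fun p : ℝ × ℝ => w p.1 p.2)
    (hle.trans_lt ENNReal.one_lt_top) (fun p _ => hw p.1 p.2)
  refine h.trans (mul_le_of_le_one_right hC ?_)
  exact ENNReal.toReal_le_of_le_ofReal zero_le_one (by simpa using hle)

theorem cutNormFn_step_le {n : ℕ} (hn : 0 < n) {M : ℕ → ℕ → ℝ} {K : ℝ} (hK : 0 ≤ K)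
    (hM : ∀ s t : ℕ → ℝ,
      (∑ i ∈ Finset.range n, ∑ j ∈ Finset.range n, M i j * s i * t j) ^ 2 ≤
        K ^ 2 * ((∑ i ∈ Finset.range n, s i ^ 2) * ∑ j ∈ Finset.range n, t j ^ 2)) :
    cutNormFn (fun x y => M ⌊(n : ℝ) * x⌋₊ ⌊(n : ℝ) * y⌋₊) ≤ K / n := by
  refine Real.sSup_le ?_ (by positivity)
  rintro r ⟨S, T, hS, hT, hS1, hT1, rfl⟩
  apply abs_le_of_sq_le_sq _ (by positivity)
  rw [setIntegral_step_Icc hn M hS hT hS1 hT1]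
  refine (hM _ _).trans ?_
  rw [div_pow, div_eq_mul_inv, sq (n : ℝ), mul_inv]
  gcongr
  · exact sum_sq_volume_floorCell_le hn hS1
  · exact sum_sq_volume_floorCell_le hn hT1

theorem le_cutNormFn_symRot_mul_chi {a : ℝ} (ha : |a| ≤ 1) (k : ℕ) :
    k * a / (2 * (2 ^ (k + 1) : ℕ)) ≤ cutNormFn (fun x y =>
      symRot a k ⌊((2 ^ (k + 1) : ℕ) : ℝ) * x⌋₊ ⌊((2 ^ (k + 1) : ℕ) : ℝ) * y⌋₊ * chi x y) := by
  have hn : 0 < 2 ^ (k + 1) := by positivity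
  have hnk : ((2 ^ (k + 1) : ℕ) : ℝ) = 2 * 2 ^ k := by push_cast; ring
  have hsum := sum_upper_symRot a k
  set n := 2 ^ (k + 1)
  have hn' : (0 : ℝ) < n := by exact_mod_cast hn
  let S : Set ℝ := {x ∈ Set.Ico (0 : ℝ) 1 | ⌊(n : ℝ) * x⌋₊ % 2 = 0}
  let T : Set ℝ := {x ∈ Set.Ico (0 : ℝ) 1 | ⌊(n : ℝ) * x⌋₊ % 2 = 1}
  have hmeas (r : ℕ) : MeasurableSet {x ∈ Set.Ico (0 : ℝ) 1 | ⌊(n : ℝ) * x⌋₊ % 2 = r} :=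
    measurableSet_Ico.inter (measurable_floor_mul n (MeasurableSet.of_discrete (s := {m | m % 2 = r})))
  have hS : MeasurableSet S := hmeas 0
  have hT : MeasurableSet T := hmeas 1
  have hS1 : S ⊆ Set.Ico 0 1 := fun x hx => hx.1
  have hT1 : T ⊆ Set.Ico 0 1 := fun x hx => hx.1
  have hbound : ∀ x y : ℝ, |symRot a k ⌊(n : ℝ) * x⌋₊ ⌊(n : ℝ) * y⌋₊ * chi x y| ≤ 2 := by
    intro x y
    unfold chi
    split_ifs
    · simpa using abs_symRot_le ha k _ _
    · simp
  refine le_trans (le_of_eq ?_) ((le_abs_self _).trans (abs_setIntegral_le_cutNormFn hbound hS hT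
    (hS1.trans Set.Ico_subset_Icc_self) (hT1.trans Set.Ico_subset_Icc_self)))
  have hcongr : Set.EqOn
      (fun p : ℝ × ℝ => symRot a k ⌊(n : ℝ) * p.1⌋₊ ⌊(n : ℝ) * p.2⌋₊ * chi p.1 p.2)
      (fun p : ℝ × ℝ => (fun i j => if i ≤ j then symRot a k i j else 0)
        ⌊(n : ℝ) * p.1⌋₊ ⌊(n : ℝ) * p.2⌋₊) (S ×ˢ T) := by
    rintro ⟨x, y⟩ ⟨⟨-, hx⟩, -, hy⟩
    simp only at hx hy ⊢
    have hiff : x ≤ y ↔ ⌊(n : ℝ) * x⌋₊ ≤ ⌊(n : ℝ) * y⌋₊ := by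
      constructor
      · intro h
        gcongr
      · intro h
        by_contra! hlt
        have : ⌊(n : ℝ) * y⌋₊ ≤ ⌊(n : ℝ) * x⌋₊ := by gcongr
        omega
    unfold chi
    by_cases h : x ≤ y
    · simp [h, hiff.1 h]
    · simp [h, mt hiff.2 h]
  rw [setIntegral_congr_fun (hS.prod hT) hcongr,
    setIntegral_step hn (fun i j => if i ≤ j then symRot a k i j else 0) hS hT hS1 hT1]
  have hterm : ∀ i ∈ Finset.range n, ∀ j ∈ Finset.range n,
      (if i ≤ j then symRot a k i j else 0) * volume.real (S ∩ floorCell n i) *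
        volume.real (T ∩ floorCell n j) =
      ((n : ℝ)⁻¹) ^ 2 * ((if i ≤ j then symRot a k i j else 0) * (if i % 2 = 0 then 1 else 0) *
        (if j % 2 = 1 then 1 else 0)) := by
    intro i hi j hj
    rw [volume_Ico_floor_inter_floorCell hn (fun m => m % 2 = 0) (Finset.mem_range.1 hi),
      volume_Ico_floor_inter_floorCell hn (fun m => m % 2 = 1) (Finset.mem_range.1 hj)]
    ring
  rw [Finset.sum_congr rfl fun i hi => Finset.sum_congr rfl (hterm i hi)]
  simp_rw [← Finset.mul_sum]
  rw [hsum, hnk]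
  field_simp

/-- For every `c > 0` there is a bounded symmetric measurable function
`w : [0,1]² → ℝ` with `‖w·χ‖_□ > c·‖w‖_□`; i.e. the triangular cut `M_χ` is unbounded
in cut norm. -/
theorem Mchi_unbounded (c : ℝ) (hc : 0 < c) :
    ∃ w : ℝ → ℝ → ℝ,
      Measurable (fun p : ℝ × ℝ => w p.1 p.2) ∧
      (∀ x y, w x y = w y x) ∧
      (∃ C : ℝ, ∀ x y, |w x y| ≤ C) ∧
      cutNormFn (fun x y => w x y * chi x y) > c * cutNormFn w := by
  obtain ⟨m, hm⟩ := exists_nat_gt (max (8 * c) 1)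
  have hm8 : 8 * c < m := (le_max_left _ _).trans_lt hm
  have hm1 : (1 : ℝ) < m := (le_max_right _ _).trans_lt hm
  have hm0 : (0 : ℝ) < m := by linarith
  set a : ℝ := (m : ℝ)⁻¹ with ha_def
  have ha : |a| ≤ 1 := by
    rw [abs_of_pos (by positivity)]
    exact inv_le_one_of_one_le₀ hm1.le
  set k : ℕ := m ^ 2 with hk
  have hpow : (1 + a ^ 2) ^ k ≤ 4 := by
    have h1 : 1 + a ^ 2 ≤ Real.exp (a ^ 2) := by linarith [Real.add_one_le_exp (a ^ 2)]
    calc (1 + a ^ 2) ^ k ≤ Real.exp (a ^ 2) ^ k := by gcongr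
      _ = Real.exp 1 := by
        rw [← Real.exp_nat_mul, hk, ha_def]
        congr 1
        push_cast
        field_simp
      _ ≤ 4 := by linarith [Real.exp_one_lt_d9]
  have hn : 0 < 2 ^ (k + 1) := by positivity
  have hupper := cutNormFn_step_le hn (M := symRot a k) (K := 4) (by norm_num) (fun s t => by
    refine (symRot_form_sq_le a k s t).trans ?_
    gcongr
    linarith)
  have hlower := le_cutNormFn_symRot_mul_chi ha k
  refine ⟨fun x y => symRot a k ⌊((2 ^ (k + 1) : ℕ) : ℝ) * x⌋₊ ⌊((2 ^ (k + 1) : ℕ) : ℝ) * y⌋₊,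
    ?_, fun x y => symRot_comm _ _ _ _, ⟨2, fun x y => abs_symRot_le ha _ _ _⟩, ?_⟩
  · exact (Measurable.of_discrete (f := fun q : ℕ × ℕ => symRot a k q.1 q.2)).comp
      (((measurable_floor_mul _).comp measurable_fst).prodMk
        ((measurable_floor_mul _).comp measurable_snd))
  · refine lt_of_le_of_lt (mul_le_mul_of_nonneg_left hupper hc.le) (lt_of_lt_of_le ?_ hlower)
    have hn' : (0 : ℝ) < (2 ^ (k + 1) : ℕ) := by exact_mod_cast hn
    have hka : (k : ℝ) * a = m := by
      rw [hk, ha_def]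
      push_cast
      field_simp
    rw [hka, ← mul_div_assoc, div_lt_div_iff₀ hn' (by positivity)]
    nlinarith
end

section
/- For every integer n ≥ 2, the cut norm of the triangular truncation of the matrix A_n equals ‖𝒯_n(A_n)‖_□ = (n·(H_{n−1} − 1) + 1)/n², where A_n is the n × n matrix with (A_n)_{ij} = 0 for i = j and (A_n)_{ij} = 1/(i−j) for i ≠ j, and H_m = Σ_{k=1}^{m} 1/k is the m-th harmonic number. -/
open MeasureTheory Filter

/-- The matrix `A_n` with `(A_n)_{ij} = 0` for `i = j` and `1/(i-j)` for `i ≠ j`. -/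
noncomputable def An (n : ℕ) : Matrix (Fin n) (Fin n) ℝ :=
  fun i j => if i = j then 0 else 1 / (((i : ℕ) : ℝ) - ((j : ℕ) : ℝ))
/-- The `m`-th harmonic number `H_m = ∑_{k=1}^m 1/k` (with `H_0 = 0`). -/
noncomputable def H (m : ℕ) : ℝ := ∑ k ∈ Finset.range m, 1 / ((k : ℝ) + 1)

theorem tri_An_nonneg (n : ℕ) (i j : Fin n) : 0 ≤ tri (An n) i j := by
  unfold tri An
  split_ifs with h
  · exact le_rfl
  · exact one_div_nonneg.2 (sub_nonneg.2 (by exact_mod_cast h))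
  · exact le_rfl

theorem sum_tri_An_row (n : ℕ) (i : Fin n) : ∑ j, tri (An n) i j = H i := by
  have hrow : ∀ j : Fin n, tri (An n) i j =
      (fun k : ℕ => if k < (i : ℕ) then 1 / (((i : ℕ) : ℝ) - (k : ℝ)) else 0) j := by
    intro j
    simp only [tri, An, Fin.ext_iff, Fin.le_def]
    split_ifs <;> first | rfl | omega
  have hfilter : (Finset.range n).filter (fun k => k < (i : ℕ)) = Finset.range i := by
    ext k
    simp only [Finset.mem_filter, Finset.mem_range]
    omega
  rw [Finset.sum_congr rfl fun j _ => hrow j,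
    Fin.sum_univ_eq_sum_range (fun k : ℕ => if k < (i : ℕ) then 1 / (((i : ℕ) : ℝ) - (k : ℝ)) else 0), ← Finset.sum_filter,
    hfilter, H, ← Finset.sum_range_reflect]
  refine Finset.sum_congr rfl fun k hk => ?_
  have hk' : k + 1 ≤ (i : ℕ) := Finset.mem_range.1 hk
  rw [Nat.sub_sub, add_comm 1 k, Nat.cast_sub hk']
  push_cast
  congr 1
  ring

theorem sum_range_H (m : ℕ) :
    ∑ k ∈ Finset.range (m + 1), H k = ((m : ℝ) + 1) * (H m - 1) + 1 := by
  induction m with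
  | zero => simp [H]
  | succ m ih =>
    have hH : H (m + 1) = H m + 1 / ((m : ℝ) + 1) := Finset.sum_range_succ _ _
    rw [Finset.sum_range_succ, ih, hH]
    have : (m : ℝ) + 1 ≠ 0 := by positivity
    push_cast
    field_simp
    ring

/-- For a matrix with nonnegative entries the supremum in the cut norm is attained at the full
index sets. -/
theorem cutNorm_of_nonneg {n : ℕ} {A : Matrix (Fin n) (Fin n) ℝ} (hA : ∀ i j, 0 ≤ A i j) :
    cutNorm A = (1 / (n : ℝ) ^ 2) * ∑ i, ∑ j, A i j := by
  have hsum : ∀ S T : Finset (Fin n), 0 ≤ ∑ i ∈ S, ∑ j ∈ T, A i j := fun S T =>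
    Finset.sum_nonneg fun i _ => Finset.sum_nonneg fun j _ => hA i j
  unfold cutNorm
  congr 1
  refine IsGreatest.csSup_eq
    ⟨⟨Finset.univ, Finset.univ, (abs_of_nonneg (hsum _ _)).symm⟩, ?_⟩
  rintro r ⟨S, T, rfl⟩
  rw [abs_of_nonneg (hsum S T)]
  calc ∑ i ∈ S, ∑ j ∈ T, A i j ≤ ∑ i ∈ S, ∑ j, A i j :=
        Finset.sum_le_sum fun i _ =>
          Finset.sum_le_sum_of_subset_of_nonneg (Finset.subset_univ T) fun j _ _ => hA i j
    _ ≤ ∑ i, ∑ j, A i j :=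
        Finset.sum_le_sum_of_subset_of_nonneg (Finset.subset_univ S) fun i _ _ =>
          Finset.sum_nonneg fun j _ => hA i j

/-- For every `n ≥ 2`, `‖𝒯ₙ(Aₙ)‖_□ = (n·(H_{n-1} - 1) + 1)/n²`. -/
theorem cutNorm_triCut_An (n : ℕ) (hn : 2 ≤ n) :
    cutNorm (tri (An n)) = ((n : ℝ) * (H (n - 1) - 1) + 1) / (n : ℝ) ^ 2 := by
  obtain ⟨m, rfl⟩ : ∃ m, n = m + 1 := ⟨n - 1, by omega⟩
  rw [cutNorm_of_nonneg (tri_An_nonneg _), Finset.sum_congr rfl fun i _ => sum_tri_An_row _ i,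
    Fin.sum_univ_eq_sum_range, sum_range_H, Nat.add_sub_cancel, Nat.cast_add_one]
  ring
end

section
/- For every positive integer n, the cut norm of the n × n matrix A_n, defined by (A_n)_{ij} = 0 for i = j and (A_n)_{ij} = 1/(i−j) for i ≠ j, satisfies ‖A_n‖_□ ≤ π/n. -/
open MeasureTheory Filter

theorem sin_intCast_mul_two_pi (k : ℤ) : Real.sin (k * (2 * Real.pi)) = 0 := by
  have h := Real.sin_int_mul_pi (k * 2)
  push_cast at h
  rwa [← mul_assoc]

theorem integral_cos_intCast_mul (k : ℤ) :
    ∫ t in (0 : ℝ)..2 * Real.pi, Real.cos (k * t) = if k = 0 then 2 * Real.pi else 0 := by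
  split_ifs with hk
  · simp [hk]
  · have hk' : (k : ℝ) ≠ 0 := by exact_mod_cast hk
    rw [intervalIntegral.integral_comp_mul_left Real.cos hk', integral_cos, sin_intCast_mul_two_pi]
    simp

theorem integral_pi_sub_mul_sin_intCast_mul (k : ℤ) :
    ∫ t in (0 : ℝ)..2 * Real.pi, (Real.pi - t) * Real.sin (k * t) = 2 * Real.pi / k := by
  rcases eq_or_ne k 0 with rfl | hk
  · simp
  have hk' : (k : ℝ) ≠ 0 := by exact_mod_cast hk
  have hderiv : ∀ t ∈ Set.uIcc (0 : ℝ) (2 * Real.pi),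
      HasDerivAt (fun t : ℝ => -((Real.pi - t) * Real.cos (k * t) / k) - Real.sin (k * t) / k ^ 2)
        ((Real.pi - t) * Real.sin (k * t)) t := by
    intro t _
    have hlin : HasDerivAt (fun t : ℝ => (k : ℝ) * t) k t := by
      simpa using (hasDerivAt_id t).const_mul (k : ℝ)
    have hpi : HasDerivAt (fun t : ℝ => Real.pi - t) (-1) t := by
      simpa using (hasDerivAt_id t).const_sub Real.pi
    refine (((hpi.mul hlin.cos).div_const (k : ℝ)).neg.sub
      (hlin.sin.div_const ((k : ℝ) ^ 2))).congr_deriv ?_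
    field_simp
    ring
  rw [intervalIntegral.integral_eq_sub_of_hasDerivAt hderiv
    ((by fun_prop : Continuous fun t : ℝ =>
      (Real.pi - t) * Real.sin (k * t)).intervalIntegrable _ _),
    sin_intCast_mul_two_pi, Real.cos_int_mul_two_pi]
  simp
  ring

/-- Parseval's identity for the trigonometric polynomial with coefficients the indicator of `S`. -/
theorem integral_sum_sin_sq_add_sum_cos_sq (S : Finset ℤ) :
    ∫ t in (0 : ℝ)..2 * Real.pi,
      ((∑ i ∈ S, Real.sin (i * t)) ^ 2 + (∑ i ∈ S, Real.cos (i * t)) ^ 2)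
      = 2 * Real.pi * S.card := by
  have hexpand : ∀ t : ℝ, (∑ i ∈ S, Real.sin (i * t)) ^ 2 + (∑ i ∈ S, Real.cos (i * t)) ^ 2
      = ∑ i ∈ S, ∑ j ∈ S, Real.cos (((i - j : ℤ) : ℝ) * t) := by
    intro t
    simp only [sq, Finset.sum_mul_sum, ← Finset.sum_add_distrib]
    refine Finset.sum_congr rfl fun i _ => Finset.sum_congr rfl fun j _ => ?_
    push_cast
    rw [sub_mul, Real.cos_sub]
    ring
  simp_rw [hexpand]
  rw [intervalIntegral.integral_finsetSum
    fun i _ => (by fun_prop : Continuous _).intervalIntegrable _ _]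
  have hrow : ∀ i ∈ S, ∫ t in (0 : ℝ)..2 * Real.pi,
      ∑ j ∈ S, Real.cos (((i - j : ℤ) : ℝ) * t) = 2 * Real.pi := by
    intro i hi
    rw [intervalIntegral.integral_finsetSum
      fun j _ => (by fun_prop : Continuous _).intervalIntegrable _ _]
    simp_rw [integral_cos_intCast_mul, sub_eq_zero]
    simp [hi]
  rw [Finset.sum_congr rfl hrow]
  simp [mul_comm]

/-- Hilbert's inequality for indicator vectors; the diagonal terms vanish since `1 / 0 = 0`. -/
theorem abs_sum_one_div_sub_le (S T : Finset ℤ) :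
    |∑ i ∈ S, ∑ j ∈ T, 1 / ((i : ℝ) - j)| ≤ Real.pi / 2 * (S.card + T.card) := by
  set a : ℝ → ℝ := fun t => ∑ i ∈ S, Real.sin (i * t) with ha
  set b : ℝ → ℝ := fun t => ∑ i ∈ S, Real.cos (i * t) with hb
  set c : ℝ → ℝ := fun t => ∑ i ∈ T, Real.sin (i * t) with hc
  set d : ℝ → ℝ := fun t => ∑ i ∈ T, Real.cos (i * t) with hd
  have hac : Continuous a := by fun_prop
  have hbc : Continuous b := by fun_prop
  have hcc : Continuous c := by fun_prop
  have hdc : Continuous d := by fun_prop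
  have hrepr : ∫ t in (0 : ℝ)..2 * Real.pi, (Real.pi - t) * (a t * d t - b t * c t)
      = 2 * Real.pi * ∑ i ∈ S, ∑ j ∈ T, 1 / ((i : ℝ) - j) := by
    have hexpand : ∀ t : ℝ, (Real.pi - t) * (a t * d t - b t * c t)
        = ∑ i ∈ S, ∑ j ∈ T, (Real.pi - t) * Real.sin (((i - j : ℤ) : ℝ) * t) := by
      intro t
      simp only [ha, hb, hc, hd, Finset.sum_mul_sum, ← Finset.sum_sub_distrib]
      simp only [Finset.mul_sum]
      refine Finset.sum_congr rfl fun i _ => Finset.sum_congr rfl fun j _ => ?_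
      push_cast
      rw [sub_mul (i : ℝ) j t, Real.sin_sub]
    simp_rw [hexpand]
    rw [intervalIntegral.integral_finsetSum
      fun i _ => (by fun_prop : Continuous _).intervalIntegrable _ _, Finset.mul_sum]
    refine Finset.sum_congr rfl fun i _ => ?_
    rw [intervalIntegral.integral_finsetSum
      fun j _ => (by fun_prop : Continuous _).intervalIntegrable _ _, Finset.mul_sum]
    refine Finset.sum_congr rfl fun j _ => ?_
    rw [integral_pi_sub_mul_sin_intCast_mul]
    push_cast
    ring
  have hbound : |∫ t in (0 : ℝ)..2 * Real.pi, (Real.pi - t) * (a t * d t - b t * c t)|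
      ≤ ∫ t in (0 : ℝ)..2 * Real.pi,
        Real.pi / 2 * ((a t ^ 2 + b t ^ 2) + (c t ^ 2 + d t ^ 2)) := by
    rw [← Real.norm_eq_abs]
    refine intervalIntegral.norm_integral_le_of_norm_le Real.two_pi_pos.le
      (Eventually.of_forall fun t ht => ?_)
      ((by fun_prop : Continuous _).intervalIntegrable _ _)
    rw [Real.norm_eq_abs, abs_mul, div_mul_eq_mul_div, mul_div_assoc]
    refine mul_le_mul ?_ ?_ (abs_nonneg _) Real.pi_pos.le
    · rw [abs_le]
      constructor <;> linarith [ht.1, ht.2]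
    · rw [abs_le]
      constructor <;>
        linarith [sq_nonneg (a t - d t), sq_nonneg (a t + d t), sq_nonneg (b t - c t),
          sq_nonneg (b t + c t)]
  rw [hrepr, intervalIntegral.integral_const_mul, intervalIntegral.integral_add
    ((by fun_prop : Continuous _).intervalIntegrable _ _)
    ((by fun_prop : Continuous _).intervalIntegrable _ _),
    integral_sum_sin_sq_add_sum_cos_sq, integral_sum_sin_sq_add_sum_cos_sq, abs_mul,
    abs_of_pos Real.two_pi_pos] at hbound
  refine le_of_mul_le_mul_left ?_ Real.two_pi_pos
  linarith

/-- For every positive integer `n`, `‖Aₙ‖_□ ≤ π/n`. -/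
theorem cutNorm_An_le (n : ℕ) (hn : 0 < n) : cutNorm (An n) ≤ Real.pi / (n : ℝ) := by
  have hn' : (0 : ℝ) < n := by exact_mod_cast hn
  have hsup : sSup {r : ℝ | ∃ S T : Finset (Fin n), r = |∑ i ∈ S, ∑ j ∈ T, An n i j|}
      ≤ Real.pi * n := by
    refine Real.sSup_le ?_ (by positivity)
    rintro r ⟨S, T, rfl⟩
    let e : Fin n ↪ ℤ := Fin.valEmbedding.trans Nat.castEmbedding
    have hsum : ∑ i ∈ S, ∑ j ∈ T, An n i j
        = ∑ i ∈ S.map e, ∑ j ∈ T.map e, 1 / ((i : ℝ) - j) := by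
      simp only [Finset.sum_map]
      refine Finset.sum_congr rfl fun i _ => Finset.sum_congr rfl fun j _ => ?_
      by_cases hij : i = j <;> simp [An, hij, e]
    have hcard : ∀ U : Finset (Fin n), (U.card : ℝ) ≤ n := fun U => by
      exact_mod_cast U.card_le_univ.trans_eq (Fintype.card_fin n)
    rw [hsum]
    refine (abs_sum_one_div_sub_le _ _).trans ?_
    rw [Finset.card_map, Finset.card_map]
    nlinarith [hcard S, hcard T, Real.pi_pos]
  calc cutNorm (An n) ≤ 1 / (n : ℝ) ^ 2 * (Real.pi * n) := by
        unfold cutNorm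
        gcongr
    _ = Real.pi / n := by field_simp
end

section
/- For every positive integer n, ‖𝒯_n(A_n)‖_opr ≥ (4/5)·log n, where A_n is the n × n matrix with (A_n)_{ij} = 0 for i = j and (A_n)_{ij} = 1/(i−j) for i ≠ j, and log denotes the natural logarithm. -/
open MeasureTheory Filter

/-- The `ℓ² → ℓ²` operator norm of an `n × n` real matrix:
`sup_{‖x‖₂ ≤ 1} ‖Ax‖₂`. -/
noncomputable def oprNorm {n : ℕ} (A : Matrix (Fin n) (Fin n) ℝ) : ℝ :=
  sSup {r : ℝ | ∃ x : Fin n → ℝ, (∑ j, (x j) ^ 2) ≤ 1 ∧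
    r = Real.sqrt (∑ i, (∑ j, A i j * x j) ^ 2)}
lemma sqrt_le_oprNorm {n : ℕ} (A : Matrix (Fin n) (Fin n) ℝ) (x : Fin n → ℝ)
    (hx : ∑ j, x j ^ 2 ≤ 1) : √(∑ i, (∑ j, A i j * x j) ^ 2) ≤ oprNorm A := by
  refine le_csSup ⟨√(∑ i, ∑ j, A i j ^ 2), ?_⟩ ⟨x, hx, rfl⟩
  rintro r ⟨y, hy, rfl⟩
  refine Real.sqrt_le_sqrt (Finset.sum_le_sum fun i _ => ?_)
  refine (Finset.sum_mul_sq_le_sq_mul_sq _ _ _).trans ?_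
  exact mul_le_of_le_one_right (by positivity) hy

lemma sum_tri_An {n : ℕ} (i : Fin n) : ∑ j, tri (An n) i j = (harmonic i : ℝ) := by
  have h : ∀ j : Fin n, tri (An n) i j =
      if (j : ℕ) < (i : ℕ) then 1 / (((i : ℕ) : ℝ) - (j : ℕ)) else 0 := by
    intro j
    simp only [tri, An, Fin.le_def, Fin.ext_iff]
    split_ifs <;> first | rfl | omega
  rw [Finset.sum_congr rfl fun j _ => h j,
    Fin.sum_univ_eq_sum_range (fun k : ℕ => if k < (i : ℕ) then 1 / (((i : ℕ) : ℝ) - k) else 0),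
    ← Finset.sum_filter,
    show (Finset.range n).filter (· < (i : ℕ)) = Finset.range i by
      ext k
      simp only [Finset.mem_filter, Finset.mem_range]
      omega,
    ← Finset.sum_range_reflect]
  simp only [harmonic, Rat.cast_sum, Rat.cast_inv, Rat.cast_natCast]
  refine Finset.sum_congr rfl fun k hk => ?_
  have hk' : k + 1 ≤ (i : ℕ) := Finset.mem_range.mp hk
  rw [Nat.sub_sub, add_comm 1 k, Nat.cast_sub hk', one_div, sub_sub_cancel]

lemma sum_range_harmonic_sq (n : ℕ) : ∑ i ∈ Finset.range n, (harmonic i : ℝ) ^ 2 =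
    n * (harmonic n : ℝ) ^ 2 - (2 * n + 1) * harmonic n + 2 * n := by
  induction n with
  | zero => simp
  | succ n ih =>
    rw [Finset.sum_range_succ, ih, harmonic_succ]
    push_cast
    have : (n : ℝ) + 1 ≠ 0 := by positivity
    field_simp
    ring

lemma log_add_half_lt_harmonic {n : ℕ} (hn : n ≠ 0) : Real.log n + 1 / 2 < harmonic n := by
  have h := Real.one_half_lt_eulerMascheroniConstant.trans
    (Real.eulerMascheroniConstant_lt_eulerMascheroniSeq' n)
  rw [Real.eulerMascheroniSeq', if_neg hn] at h
  linarith

lemma mul_sq_log_le_sum_harmonic_sq {n : ℕ} (hn : 0 < n) :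
    n * (4 / 5 * Real.log n) ^ 2 ≤ ∑ i ∈ Finset.range n, (harmonic i : ℝ) ^ 2 := by
  have hl : 0 ≤ Real.log n := Real.log_natCast_nonneg n
  rw [sum_range_harmonic_sq]
  rcases lt_or_ge n 4 with h | h
  · have h2 := Real.log_two_lt_d9
    interval_cases n
    · norm_num [harmonic]
    · norm_num [harmonic, Finset.sum_range_succ] at *
      nlinarith
    · have h3 : Real.log 3 ≤ 1.14 := by
        have h4 : Real.log 3 = Real.log (3 / 4) + 2 * Real.log 2 := by
          rw [← Real.log_rpow two_pos, ← Real.log_mul (by norm_num) (by positivity)]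
          norm_num
        have := Real.log_le_sub_one_of_pos (show (0 : ℝ) < 3 / 4 by norm_num)
        linarith
      norm_num [harmonic, Finset.sum_range_succ] at *
      nlinarith
  · have hH := log_add_half_lt_harmonic hn.ne'
    generalize Real.log n = l at *
    generalize (harmonic n : ℝ) = H at *
    have hn4 : (4 : ℝ) ≤ n := by exact_mod_cast h
    have hsq : (4 / 5 * l) ^ 2 ≤ (4 / 5 * (H - 1 / 2)) ^ 2 :=
      pow_le_pow_left₀ (by positivity) (by linarith) 2
    have hquad : (4 / 5 * (H - 1 / 2)) ^ 2 ≤ H ^ 2 - (2 + 1 / 4) * H + 2 := by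
      nlinarith [sq_nonneg (H - 2.236)]
    nlinarith [mul_le_mul_of_nonneg_left (hsq.trans hquad) (by linarith : (0 : ℝ) ≤ n)]

/-- For every positive integer `n`, `‖𝒯ₙ(Aₙ)‖_opr ≥ (4/5)·log n`. -/
theorem oprNorm_triCut_An_ge (n : ℕ) (hn : 0 < n) :
    oprNorm (tri (An n)) ≥ 4 / 5 * Real.log n := by
  have hn' : (0 : ℝ) < n := by exact_mod_cast hn
  have hx : ∑ _j : Fin n, (√(n : ℝ))⁻¹ ^ 2 ≤ 1 := by
    simp [inv_pow, Real.sq_sqrt hn'.le, hn'.ne']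
  refine le_trans ?_ (sqrt_le_oprNorm (tri (An n)) (fun _ => (√(n : ℝ))⁻¹) hx)
  apply Real.le_sqrt_of_sq_le
  simp only [← Finset.sum_mul, sum_tri_An, mul_pow, inv_pow, Real.sq_sqrt hn'.le]
  rw [Fin.sum_univ_eq_sum_range (fun i => (harmonic i : ℝ) ^ 2), ← div_eq_mul_inv,
    le_div_iff₀ hn', mul_comm, ← mul_pow]
  exact mul_sq_log_le_sum_harmonic_sq hn
end

section
/- Let A and B be n × n real matrices and suppose all diagonal entries of A are zero. Then 𝒯_{n²}(A ⊗ B) = (𝒯_n(A)) ⊗ B, i.e., T_{n²} ∘ (A ⊗ B) = (T_n ∘ A) ⊗ B, where ⊗ denotes the Kronecker product with lexicographic indexing (A ⊗ B)_{(i-1)n+k,(j-1)n+l} = a_{ij}·b_{kl}. -/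
open MeasureTheory Filter

theorem finProdFinEquiv_lt_of_fst_lt {m n : ℕ} {i j : Fin m} (h : i < j) (k l : Fin n) :
    finProdFinEquiv (i, k) < finProdFinEquiv (j, l) := by
  rw [Fin.lt_def, finProdFinEquiv_apply_val, finProdFinEquiv_apply_val]
  have hmul : n * (i + 1) ≤ n * j := Nat.mul_le_mul_left n h
  have hk := k.isLt
  rw [mul_add] at hmul
  dsimp only
  omega

/-- If all diagonal entries of `A` are zero, then
`𝒯_{n²}(A ⊗ B) = (𝒯ₙ(A)) ⊗ B`. -/
theorem triCut_kron (n : ℕ) (A B : Matrix (Fin n) (Fin n) ℝ)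
    (hA : ∀ i, A i i = 0) :
    tri (kron A B) = kron (tri A) B := by
  ext p q
  obtain ⟨⟨i, k⟩, rfl⟩ := finProdFinEquiv.surjective p
  obtain ⟨⟨j, l⟩, rfl⟩ := finProdFinEquiv.surjective q
  simp only [tri, kron, Matrix.reindex_apply, Matrix.submatrix_apply, Equiv.symm_apply_apply,
    Matrix.kroneckerMap_apply]
  rcases lt_trichotomy i j with h | rfl | h
  · rw [if_neg (finProdFinEquiv_lt_of_fst_lt h k l).not_ge, if_neg h.not_ge, zero_mul]
  · simp [hA]
  · rw [if_pos (finProdFinEquiv_lt_of_fst_lt h l k).le, if_pos h.le]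
end

section
/- If w : [0,1]² → ℝ is a symmetric, nonnegative, integrable function, then ‖w·χ‖_□ ≤ (1/2)·‖w‖_□. -/
open MeasureTheory Filter

/-- The diagonal of the plane is a null set. -/
lemma ae_fst_ne_snd : ∀ᵐ p : ℝ × ℝ, p.1 ≠ p.2 := by
  have hm : MeasurableSet {p : ℝ × ℝ | p.1 = p.2} :=
    measurableSet_eq_fun measurable_fst measurable_snd
  have h : (volume : Measure (ℝ × ℝ)) {p : ℝ × ℝ | p.1 = p.2} = 0 := by
    rw [Measure.volume_eq_prod, Measure.measure_prod_null hm]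
    refine Eventually.of_forall fun x => ?_
    have : Prod.mk x ⁻¹' {p : ℝ × ℝ | p.1 = p.2} = {x} := by
      ext y
      simp [eq_comm]
    simp [this]
  rw [ae_iff]
  simpa using h

lemma chi_nonneg (x y : ℝ) : 0 ≤ chi x y := by
  unfold chi
  split_ifs <;> norm_num

lemma measurable_chi : Measurable fun p : ℝ × ℝ => chi p.1 p.2 :=
  Measurable.ite (measurableSet_le measurable_fst measurable_snd) measurable_const
    measurable_const

lemma chi_add_chi_swap {x y : ℝ} (h : x ≠ y) : chi x y + chi y x = 1 := by
  unfold chi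
  rcases lt_or_gt_of_ne h with h | h
  · simp [h.le, h.not_ge]
  · simp [h.le, h.not_ge]

lemma integrableOn_mul_chi {w : ℝ → ℝ → ℝ} {Q : Set (ℝ × ℝ)}
    (h : IntegrableOn (fun p : ℝ × ℝ => w p.1 p.2) Q) :
    IntegrableOn (fun p : ℝ × ℝ => w p.1 p.2 * chi p.1 p.2) Q := by
  refine Integrable.mul_bdd (c := 1) h measurable_chi.aestronglyMeasurable
    (Eventually.of_forall fun p => ?_)
  unfold chi
  split_ifs <;> norm_num

/-- Integrating a symmetric function over the part of a square above the diagonal gives half of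
its integral over the square. -/
lemma setIntegral_mul_chi {w : ℝ → ℝ → ℝ} {A : Set ℝ} (hA : MeasurableSet A)
    (hint : IntegrableOn (fun p : ℝ × ℝ => w p.1 p.2) (A ×ˢ A))
    (hsymm : ∀ x ∈ A, ∀ y ∈ A, w x y = w y x) :
    ∫ p in A ×ˢ A, w p.1 p.2 * chi p.1 p.2 = (1 / 2) * ∫ p in A ×ˢ A, w p.1 p.2 := by
  have hQ : MeasurableSet (A ×ˢ A) := hA.prod hA
  have hmp : MeasurePreserving (Prod.swap : ℝ × ℝ → ℝ × ℝ) volume volume :=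
    Measure.measurePreserving_swap
  have hemb : MeasurableEmbedding (Prod.swap : ℝ × ℝ → ℝ × ℝ) :=
    MeasurableEquiv.prodComm.measurableEmbedding
  have hpre : (Prod.swap : ℝ × ℝ → ℝ × ℝ) ⁻¹' (A ×ˢ A) = A ×ˢ A := Set.preimage_swap_prod A A
  have hswap : ∫ p in A ×ˢ A, w p.2 p.1 * chi p.2 p.1
      = ∫ p in A ×ˢ A, w p.1 p.2 * chi p.1 p.2 := by
    have h := hmp.setIntegral_preimage_emb hemb (fun p => w p.1 p.2 * chi p.1 p.2) (A ×ˢ A)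
    rwa [hpre] at h
  have hint' : IntegrableOn (fun p : ℝ × ℝ => w p.2 p.1 * chi p.2 p.1) (A ×ˢ A) := by
    have h := (hmp.integrableOn_comp_preimage hemb (s := A ×ˢ A)).2 (integrableOn_mul_chi hint)
    rwa [hpre] at h
  have hsum : ∫ p in A ×ˢ A, w p.1 p.2 = ∫ p in A ×ˢ A,
      (w p.1 p.2 * chi p.1 p.2 + w p.2 p.1 * chi p.2 p.1) := by
    refine setIntegral_congr_ae hQ ?_
    filter_upwards [ae_fst_ne_snd] with p hp hpQ
    rw [← hsymm p.1 hpQ.1 p.2 hpQ.2, ← mul_add, chi_add_chi_swap hp, mul_one]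
  rw [integral_add (integrableOn_mul_chi hint) hint', hswap] at hsum
  linarith

/-- If `w : [0,1]² → ℝ` is symmetric, nonnegative and integrable, then
`‖w·χ‖_□ ≤ (1/2)·‖w‖_□`. -/
theorem cutNormFn_chi_le_half (w : ℝ → ℝ → ℝ)
    (hint : IntegrableOn (fun p : ℝ × ℝ => w p.1 p.2) (Set.Icc 0 1 ×ˢ Set.Icc 0 1))
    (hsymm : ∀ x ∈ Set.Icc (0:ℝ) 1, ∀ y ∈ Set.Icc (0:ℝ) 1, w x y = w y x)
    (hpos : ∀ x ∈ Set.Icc (0:ℝ) 1, ∀ y ∈ Set.Icc (0:ℝ) 1, 0 ≤ w x y) :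
    cutNormFn (fun x y => w x y * chi x y) ≤ (1 / 2) * cutNormFn w := by
  have abs_le : ∀ v : ℝ → ℝ → ℝ,
      IntegrableOn (fun p : ℝ × ℝ => v p.1 p.2) (Set.Icc 0 1 ×ˢ Set.Icc 0 1) →
      (∀ x ∈ Set.Icc (0:ℝ) 1, ∀ y ∈ Set.Icc (0:ℝ) 1, 0 ≤ v x y) →
      ∀ S T : Set ℝ, MeasurableSet S → MeasurableSet T → S ⊆ Set.Icc 0 1 → T ⊆ Set.Icc 0 1 →
      |∫ p in S ×ˢ T, v p.1 p.2| ≤ ∫ p in Set.Icc 0 1 ×ˢ Set.Icc 0 1, v p.1 p.2 := by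
    intro v hv hv0 S T hS hT hS1 hT1
    rw [abs_of_nonneg (setIntegral_nonneg (hS.prod hT)
      fun p hp => hv0 _ (hS1 hp.1) _ (hT1 hp.2))]
    refine setIntegral_mono_set hv ?_ (Set.prod_mono hS1 hT1).eventuallyLE
    filter_upwards [ae_restrict_mem (measurableSet_Icc.prod measurableSet_Icc)] with p hp
    exact hv0 _ hp.1 _ hp.2
  have hle : ∫ p in Set.Icc 0 1 ×ˢ Set.Icc 0 1, w p.1 p.2 ≤ cutNormFn w := by
    refine le_csSup ⟨∫ p in Set.Icc 0 1 ×ˢ Set.Icc 0 1, w p.1 p.2, ?_⟩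
      ⟨Set.Icc 0 1, Set.Icc 0 1, measurableSet_Icc, measurableSet_Icc, subset_rfl, subset_rfl,
        (abs_of_nonneg (setIntegral_nonneg
        (measurableSet_Icc.prod measurableSet_Icc) fun p hp => hpos _ hp.1 _ hp.2)).symm⟩
    rintro r ⟨S, T, hS, hT, hS1, hT1, rfl⟩
    exact abs_le w hint hpos S T hS hT hS1 hT1
  refine csSup_le ⟨_, ∅, ∅, .empty, .empty, Set.empty_subset _, Set.empty_subset _, rfl⟩ ?_
  rintro r ⟨S, T, hS, hT, hS1, hT1, rfl⟩
  refine (abs_le (fun x y => w x y * chi x y) (integrableOn_mul_chi hint)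
    (fun x hx y hy => mul_nonneg (hpos x hx y hy) (chi_nonneg x y))
    S T hS hT hS1 hT1).trans ?_
  rw [setIntegral_mul_chi measurableSet_Icc hint hsymm]
  linarith
end
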